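/- arXiv:1003.3998 — 3 statements merged into one kernel-verified Lean document; each statement's English description precedes it below -/
import Mathlib

section
/- Let G and H be countable groups with H amenable, let π : G → H be a surjective group homomorphism, and let A be a subgroup of G such that the restriction of π to A is injective and the index of π(A) in H is at least 2. Then the amalgamated free product G ∗_A H taken along the inclusion A ↪ G and the injective homomorphism π|_A : A → H belongs to the class 𝒜. -/
/-- A `G`-invariant mean on `X`, for the `G`-action on `X` given by `φ`:
a finitely additive probability "measure" on the subsets of `X` invariant under `G`. -/
def IsInvariantMean {G X : Type*} [Group G] (φ : G →* Equiv.Perm X)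
    (μ : Set X → ℝ) : Prop :=
  (∀ S : Set X, 0 ≤ μ S) ∧ μ Set.univ = 1 ∧
  (∀ S T : Set X, Disjoint S T → μ (S ∪ T) = μ S + μ T) ∧
  (∀ (g : G) (S : Set X), μ ((φ g) '' S) = μ S)

/-- The action of `G` on `X` given by `φ` is amenable: there is a `G`-invariant mean on `X`. -/
def AmenableAction {G X : Type*} [Group G] (φ : G →* Equiv.Perm X) : Prop :=
  ∃ μ : Set X → ℝ, IsInvariantMean φ μ

/-- A group is amenable if its left-translation action on itself is amenable. -/
def AmenableGroup (G : Type*) [Group G] : Prop :=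
  AmenableAction (MulAction.toPermHom G G)

/-- A group `G` is in the class `𝒜` if it admits a transitive, faithful and
amenable action on some countable set. -/
def InClassA (G : Type*) [Group G] : Prop :=
  ∃ (X : Type) (_ : Countable X) (φ : G →* Equiv.Perm X),
    Function.Injective φ ∧ (∀ x y : X, ∃ g : G, φ g x = y) ∧ AmenableAction φ

/-- `(P, jG, jH)` is the amalgamated free product of `G` and `H` over `A`
(along the homomorphisms `iG : A →* G` and `iH : A →* H`), i.e. it is a pushout
of `iG` and `iH` in the category of groups. -/
def IsAmalgamatedProduct {A G H P : Type*} [Group A] [Group G] [Group H] [Group P]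
    (iG : A →* G) (iH : A →* H) (jG : G →* P) (jH : H →* P) : Prop :=
  jG.comp iG = jH.comp iH ∧
  ∀ (L : Type) [Group L] (fG : G →* L) (fH : H →* L),
    fG.comp iG = fH.comp iH → ∃! f : P →* L, f.comp jG = fG ∧ f.comp jH = fH

open Filter Topology in
theorem exists_tendsto_hyperfilter {a : ℕ → ℝ} (h₀ : ∀ n, 0 ≤ a n) (h₁ : ∀ n, a n ≤ 1) :
    ∃ x, Tendsto a (hyperfilter ℕ) (𝓝 x) := by
  obtain ⟨x, -, hx⟩ := (isCompact_Icc (a := (0 : ℝ)) (b := 1)).ultrafilter_le_nhds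
    ((hyperfilter ℕ).map a) (by
      rw [Ultrafilter.coe_map, le_principal_iff, mem_map]
      exact Eventually.of_forall fun n ↦ ⟨h₀ n, h₁ n⟩)
  exact ⟨x, hx⟩

open Filter Topology in
/-- Averaging an invariant mean on `H` along a sequence `r` in `V` gives a mean on `V × H` which is
invariant under translations of the second coordinate, and under permutations that shift `r` by
one step over a subset `D` of `H`. -/
theorem exists_mean_prod {H V : Type*} [Group H] (hH : AmenableGroup H) (r : ℕ → V) (D : Set H) :
    ∃ μ : Set (V × H) → ℝ, (∀ S, 0 ≤ μ S) ∧ μ Set.univ = 1 ∧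
      (∀ S T, Disjoint S T → μ (S ∪ T) = μ S + μ T) ∧
      (∀ (e : V × H → V × H) (h : H), (∀ i q, e (r i, q) = (r i, h * q)) →
        ∀ S, μ (e ⁻¹' S) = μ S) ∧
      (∀ e : V × H → V × H, (∀ i, ∀ q ∉ D, e (r i, q) = (r i, q)) →
        (∀ i, ∀ q ∈ D, e (r i, q) = (r (i + 1), q)) → ∀ S, μ (e ⁻¹' S) = μ S) := by
  obtain ⟨ν, ν_nonneg, ν_univ, ν_union, ν_inv⟩ := hH
  have ν_le (S : Set H) : ν S ≤ 1 := by
    have := ν_union S Sᶜ disjoint_compl_right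
    rw [Set.union_compl_self, ν_univ] at this
    linarith [ν_nonneg Sᶜ]
  set F : ℕ → Set (V × H) → Set H := fun i S ↦ {q | (r i, q) ∈ S} with hF
  set a : Set (V × H) → ℕ → ℝ := fun S n ↦ (∑ i ∈ Finset.range (n + 1), ν (F i S)) / (n + 1)
    with ha
  have a_nonneg (S n) : 0 ≤ a S n :=
    div_nonneg (Finset.sum_nonneg fun _ _ ↦ ν_nonneg _) (by positivity)
  have a_le (S n) : a S n ≤ 1 := by
    rw [ha, div_le_one (by positivity)]
    calc _ ≤ ∑ i ∈ Finset.range (n + 1), (1 : ℝ) := Finset.sum_le_sum fun _ _ ↦ ν_le _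
      _ = _ := by simp
  choose μ hμ using fun S ↦ exists_tendsto_hyperfilter (a_nonneg S) (a_le S)
  have inv_of_eq {S T} (h : ∀ i, ν (F i S) = ν (F i T)) : μ S = μ T := by
    refine tendsto_nhds_unique (hμ S) ?_
    simpa only [ha, h] using hμ T
  refine ⟨μ, fun S ↦ ge_of_tendsto' (hμ S) (a_nonneg S), ?_, fun S T hST ↦ ?_,
    fun e h he S ↦ inv_of_eq fun i ↦ ?_, fun e he₀ he₁ S ↦ ?_⟩
  · refine tendsto_nhds_unique (hμ _) (tendsto_const_nhds.congr fun n ↦ ?_)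
    have : (n : ℝ) + 1 ≠ 0 := by positivity
    simp [ha, hF, ν_univ, this]
  · refine tendsto_nhds_unique (hμ _) (((hμ S).add (hμ T)).congr fun n ↦ ?_)
    simp only [ha]
    rw [← add_div, ← Finset.sum_add_distrib]
    congr 1
    refine Finset.sum_congr rfl fun i _ ↦ (ν_union _ _ ?_).symm
    exact Set.disjoint_left.2 fun q hS hT ↦ Set.disjoint_left.1 hST hS hT
  · rw [← ν_inv h]
    congr 1
    ext q
    simp only [hF, Set.mem_image, Set.mem_ofPred_eq, Set.mem_preimage, he]
    constructor
    · rintro ⟨x, hx, rfl⟩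
      exact hx
    · exact fun hq ↦ ⟨h⁻¹ * q, by simpa using hq, by simp⟩
  · have split (i : ℕ) : ν (F i (e ⁻¹' S)) - ν (F i S) = ν (D ∩ F (i + 1) S) - ν (D ∩ F i S) := by
      have e1 : F i (e ⁻¹' S) = (D ∩ F (i + 1) S) ∪ (F i S \ D) := by
        ext q
        by_cases hq : q ∈ D
        · simp [hF, he₁ i q hq, hq]
        · simp [hF, he₀ i q hq, hq]
      have e2 : F i S = (D ∩ F i S) ∪ (F i S \ D) := by
        rw [Set.inter_comm, Set.inter_union_sdiff]
      have d (X Y : Set H) : Disjoint (D ∩ X) (Y \ D) :=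
        Set.disjoint_left.2 fun q h h' ↦ h'.2 h.1
      have h2 := ν_union _ _ (d (F i S) (F i S))
      rw [← e2] at h2
      rw [e1, ν_union _ _ (d _ _), h2]
      ring
    have diff (n : ℕ) : a (e ⁻¹' S) n - a S n =
        (ν (D ∩ F (n + 1) S) - ν (D ∩ F 0 S)) / (n + 1) := by
      simp only [ha]
      rw [← sub_div, ← Finset.sum_sub_distrib, Finset.sum_congr rfl fun i _ ↦ split i,
        Finset.sum_range_sub (fun i ↦ ν (D ∩ F i S))]
    have lim : Tendsto (fun n ↦ a (e ⁻¹' S) n - a S n) (hyperfilter ℕ) (𝓝 0) := by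
      refine Tendsto.mono_left ?_ Nat.hyperfilter_le_atTop
      refine squeeze_zero_norm (fun n ↦ ?_) tendsto_one_div_add_atTop_nhds_zero_nat
      rw [diff, norm_div, Real.norm_of_nonneg (show (0 : ℝ) ≤ n + 1 by positivity)]
      gcongr
      rw [Real.norm_eq_abs, abs_le]
      constructor <;> linarith [ν_nonneg (D ∩ F (n + 1) S), ν_nonneg (D ∩ F 0 S),
        ν_le (D ∩ F (n + 1) S), ν_le (D ∩ F 0 S)]
    exact sub_eq_zero.1 (tendsto_nhds_unique ((hμ _).sub (hμ S)) lim)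

section ShiftProduct

open Monoid

variable (K : Type) [Group K]

/-- The shift automorphism of the free product of `ℤ` copies of `K`. -/
def coprodIShift : MulAut (CoprodI fun _ : ℤ ↦ K) :=
  MonoidHom.toMulEquiv (CoprodI.lift fun i ↦ CoprodI.of (M := fun _ : ℤ ↦ K) (i := i + 1))
    (CoprodI.lift fun i ↦ CoprodI.of (M := fun _ : ℤ ↦ K) (i := i - 1))
    (by ext i k; simp) (by ext i k; simp)

variable {K}

theorem coprodIShift_of (i : ℤ) (k : K) :
    coprodIShift K (CoprodI.of (M := fun _ : ℤ ↦ K) (i := i) k) =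
      CoprodI.of (M := fun _ : ℤ ↦ K) (i := i + 1) k := by
  simp [coprodIShift]

theorem coprodIShift_zpow_of (n i : ℤ) (k : K) :
    (coprodIShift K ^ n) (CoprodI.of (M := fun _ : ℤ ↦ K) (i := i) k) =
      CoprodI.of (M := fun _ : ℤ ↦ K) (i := i + n) k := by
  induction n using Int.induction_on generalizing i with
  | zero => simp
  | succ n ih =>
    rw [zpow_add_one, MulAut.mul_apply, coprodIShift_of, ih, add_right_comm, add_assoc]
  | pred n ih =>
    have h : (coprodIShift K)⁻¹ (CoprodI.of (M := fun _ : ℤ ↦ K) (i := i) k) =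
        CoprodI.of (M := fun _ : ℤ ↦ K) (i := i - 1) k := by
      rw [MulAut.inv_apply, MulEquiv.symm_apply_eq, coprodIShift_of, sub_add_cancel]
    rw [zpow_sub_one, MulAut.mul_apply, h, ih]
    congr 2
    ring

/-- The subgroup of the free product of `ℤ` copies of `K` generated by the copies of index at most
`n`. -/
def coprodITail (K : Type) [Group K] (n : ℤ) : Subgroup (CoprodI fun _ : ℤ ↦ K) :=
  Subgroup.closure {x | ∃ i ≤ n, ∃ k : K, x = CoprodI.of (M := fun _ : ℤ ↦ K) (i := i) k}

/-- The endomorphism of the free product of `ℤ` copies of `K` that kills the copies of index at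
most `n` and fixes the others. -/
def coprodITrunc (K : Type) [Group K] (n : ℤ) :
    (CoprodI fun _ : ℤ ↦ K) →* (CoprodI fun _ : ℤ ↦ K) :=
  CoprodI.lift fun i ↦ if i ≤ n then 1 else CoprodI.of (M := fun _ : ℤ ↦ K) (i := i)

theorem coprodITrunc_eq_one {n : ℤ} {x : CoprodI fun _ : ℤ ↦ K} (hx : x ∈ coprodITail K n) :
    coprodITrunc K n x = 1 := by
  rw [← MonoidHom.mem_ker]
  refine (Subgroup.closure_le _).2 ?_ hx
  rintro _ ⟨i, hi, k, rfl⟩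
  simp [coprodITrunc, MonoidHom.mem_ker, hi]

theorem exists_coprodITrunc_eq_self (x : CoprodI fun _ : ℤ ↦ K) :
    ∃ m : ℕ, ∀ n : ℤ, n ≤ -m → coprodITrunc K n x = x := by
  induction x using CoprodI.induction_on with
  | one => exact ⟨0, by simp⟩
  | of i k =>
    refine ⟨i.natAbs + 1, fun n hn ↦ ?_⟩
    have : ¬ i ≤ n := by omega
    simp [coprodITrunc, this]
  | mul x y hx hy =>
    obtain ⟨m, hm⟩ := hx
    obtain ⟨m', hm'⟩ := hy
    refine ⟨m + m', fun n hn ↦ ?_⟩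
    push_cast at hn
    rw [map_mul, hm n (by omega), hm' n (by omega)]

theorem coprodIShift_zpow_mem_tail {x : CoprodI fun _ : ℤ ↦ K} {m : ℤ} (hx : x ∈ coprodITail K m)
    (n : ℤ) : (coprodIShift K ^ n) x ∈ coprodITail K (m + n) := by
  suffices coprodITail K m ≤ (coprodITail K (m + n)).comap (coprodIShift K ^ n).toMonoidHom from
    this hx
  refine (Subgroup.closure_le _).2 ?_
  rintro _ ⟨i, hi, k, rfl⟩
  refine Subgroup.subset_closure ⟨i + n, by omega, k, ?_⟩
  simpa using coprodIShift_zpow_of n i k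

/-- The free product of `K` and an infinite cyclic group, together with a core-free subgroup
whose coset space contains a ray shifted by the generator and fixed by `K`. -/
theorem exists_freeProduct_int (K : Type) [Group K] :
    ∃ (W : Type) (_ : Group W) (ι : K →* W) (t : W),
      (∀ (P : Type) [Group P] (f : K →* P) (x : P), ∃ ψ : W →* P, ψ.comp ι = f ∧ ψ t = x) ∧
      (∀ S : Subgroup W, (∀ k, ι k ∈ S) → t ∈ S → S = ⊤) ∧
      ∃ M : Subgroup W, M.normalCore = ⊥ ∧ ∀ (k : K) (i : ℕ), (t ^ i)⁻¹ * ι k * t ^ i ∈ M := by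
  let φ : Multiplicative ℤ →* MulAut (CoprodI fun _ : ℤ ↦ K) := zpowersHom _ (coprodIShift K)
  have hφ (n : Multiplicative ℤ) : φ n = coprodIShift K ^ n.toAdd := rfl
  let t : (CoprodI fun _ : ℤ ↦ K) ⋊[φ] Multiplicative ℤ :=
    SemidirectProduct.inr (Multiplicative.ofAdd 1)
  have ht (n : ℤ) : t ^ n = SemidirectProduct.inr (Multiplicative.ofAdd n) := by
    rw [← map_zpow, ← ofAdd_zsmul]
    simp
  have conj (x : CoprodI fun _ : ℤ ↦ K) (n : ℤ) :
      t ^ n * SemidirectProduct.inl x * (t ^ n)⁻¹ =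
        SemidirectProduct.inl ((coprodIShift K ^ n) x) := by
    have := SemidirectProduct.inl_aut (φ := φ) (Multiplicative.ofAdd n) x
    rw [hφ, map_inv, ← ht] at this
    exact this.symm
  refine ⟨(CoprodI fun _ : ℤ ↦ K) ⋊[φ] Multiplicative ℤ, inferInstance,
    SemidirectProduct.inl.comp (CoprodI.of (M := fun _ : ℤ ↦ K) (i := 0)), t,
    fun P _ f x ↦ ?_, fun S hι hS ↦ ?_,
    (coprodITail K 0).map SemidirectProduct.inl, ?_, fun k i ↦ ?_⟩
  · refine ⟨SemidirectProduct.lift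
      (CoprodI.lift fun i ↦ (MulAut.conj (x ^ i)).toMonoidHom.comp f) (zpowersHom _ x)
      fun g ↦ ?_, ?_, ?_⟩
    · ext i k
      simp [hφ, coprodIShift_zpow_of, add_comm i, zpow_add]
    · ext k
      simp
    · simp [t]
  · have hF (x : CoprodI fun _ : ℤ ↦ K) : SemidirectProduct.inl x ∈ S := by
      induction x using CoprodI.induction_on with
      | one => simp
      | of i k =>
        have := conj (CoprodI.of (M := fun _ : ℤ ↦ K) (i := 0) k) i
        rw [coprodIShift_zpow_of, zero_add] at this
        rw [← this]
        exact S.mul_mem (S.mul_mem (S.zpow_mem hS i) (hι k)) (S.inv_mem (S.zpow_mem hS i))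
      | mul x y hx hy => rw [map_mul]; exact S.mul_mem hx hy
    refine eq_top_iff.2 fun w _ ↦ ?_
    rw [← SemidirectProduct.inl_left_mul_inr_right w]
    refine S.mul_mem (hF _) ?_
    have := ht w.right.toAdd
    rw [ofAdd_toAdd] at this
    exact this ▸ S.zpow_mem hS _
  · refine (Subgroup.eq_bot_iff_forall _).2 fun w hw ↦ ?_
    obtain ⟨x, -, rfl⟩ := Subgroup.normalCore_le _ hw
    obtain ⟨m, hm⟩ := exists_coprodITrunc_eq_self x
    obtain ⟨y, hy, hxy⟩ := hw (t ^ (m : ℤ))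
    rw [conj] at hxy
    rw [← hm (-m) le_rfl, coprodITrunc_eq_one, map_one]
    have := coprodIShift_zpow_mem_tail hy (-m)
    rw [SemidirectProduct.inl_injective hxy, zpow_neg, MulAut.inv_apply_self, zero_add] at this
    exact this
  · have := conj (CoprodI.of (M := fun _ : ℤ ↦ K) (i := 0) k) (-i)
    rw [zpow_neg, inv_inv, zpow_natCast, coprodIShift_zpow_of] at this
    refine ⟨_, Subgroup.subset_closure ⟨0 + -i, by omega, k, rfl⟩, this.symm⟩

end ShiftProduct

open Monoid in
/-- The free product of `K` and a free group on the points of `C` other than `c₀` acts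
transitively and faithfully on a set containing a ray which is shifted by one generator and fixed
by `K` and by the other generators. -/
theorem exists_faithful_action_with_ray (K C : Type) [Group K] (c₀ c₁ : C) (hne : c₁ ≠ c₀) :
    ∃ (W : Type) (_ : Group W) (κ : K →* W) (u : C → W), u c₀ = 1 ∧
      (∀ (P : Type) [Group P] (f : K →* P) (c : C → P), c c₀ = 1 →
        ∃ ψ : W →* P, (∀ k, ψ (κ k) = f k) ∧ ∀ x, ψ (u x) = c x) ∧
      (∀ S : Subgroup W, (∀ k, κ k ∈ S) → (∀ x, u x ∈ S) → S = ⊤) ∧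
      ∃ (V : Type) (_ : MulAction W V), FaithfulSMul W V ∧ MulAction.IsPretransitive W V ∧
        ∃ r : ℕ → V, (∀ k i, κ k • r i = r i) ∧ (∀ x ≠ c₁, ∀ i, u x • r i = r i) ∧
          ∀ i, u c₁ • r i = r (i + 1) := by
  classical
  obtain ⟨W, _, ι, t, hψ, hgen, M, hM, hray⟩ :=
    exists_freeProduct_int (Coprod K (FreeGroup {x : C // x ≠ c₀ ∧ x ≠ c₁}))
  have fix (k i) : ι k • ((t ^ i : W) : W ⧸ M) = ((t ^ i : W) : W ⧸ M) := by
    rw [MulAction.Quotient.smul_coe, smul_eq_mul, eq_comm, QuotientGroup.eq, ← mul_assoc]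
    exact hray k i
  let u : C → W := fun x ↦ if h₀ : x = c₀ then 1 else if h₁ : x = c₁ then t else
    ι (Coprod.inr (FreeGroup.of ⟨x, h₀, h₁⟩))
  have u₁ : u c₁ = t := by simp [u, hne]
  refine ⟨W, inferInstance, ι.comp Coprod.inl, u, by simp [u], fun P _ f c hc ↦ ?_,
    fun S hκ hu ↦ hgen S (fun k ↦ ?_) (u₁ ▸ hu c₁), W ⧸ M, inferInstance, ?_, inferInstance,
    fun i ↦ ((t ^ i : W) : W ⧸ M), fun k i ↦ fix _ i, fun x hx i ↦ ?_, fun i ↦ ?_⟩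
  · obtain ⟨ψ, hι, ht⟩ := hψ P (Coprod.lift f (FreeGroup.lift fun x ↦ c x.1)) (c c₁)
    have hι' (k) : ψ (ι k) = _ := DFunLike.congr_fun hι k
    refine ⟨ψ, fun k ↦ by simp [hι'], fun x ↦ ?_⟩
    by_cases h₀ : x = c₀
    · simp [u, h₀, hc]
    by_cases h₁ : x = c₁
    · rw [h₁, u₁, ht]
    · simp [u, h₀, h₁, hι']
  · induction k using Coprod.induction_on with
    | inl k => exact hκ k
    | inr y =>
      induction y using FreeGroup.induction_on with
      | C1 => simp
      | of x => simpa [u, x.2.1, x.2.2] using hu x.1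
      | inv_of x h => simpa using h
      | mul x y hx hy => simpa using S.mul_mem hx hy
    | mul x y hx hy => rw [map_mul]; exact S.mul_mem hx hy
  · refine ⟨fun {a b} h ↦ ?_⟩
    rw [← inv_mul_eq_one, ← Subgroup.mem_bot, ← hM]
    intro g
    have := h ((g⁻¹ : W) : W ⧸ M)
    rw [MulAction.Quotient.smul_coe, MulAction.Quotient.smul_coe, QuotientGroup.eq] at this
    simpa [mul_assoc] using this
  · by_cases h₀ : x = c₀
    · simp [u, h₀]
    · simpa [u, h₀, hx] using fix _ i
  · rw [u₁, MulAction.Quotient.smul_coe, smul_eq_mul, ← pow_succ']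

/-- A surjective homomorphism that is injective on `A` has a section equivariant under left
multiplication by `A`. -/
theorem exists_equivariant_section {G H : Type*} [Group G] [Group H] {π : G →* H}
    (hπ : Function.Surjective π) {A : Subgroup G}
    (hinj : Function.Injective (π.comp A.subtype)) :
    ∃ s : H → G, (∀ h, π (s h) = h) ∧ s 1 = 1 ∧ ∀ a ∈ A, ∀ h, s (π a * h) = a * s h := by
  let R := QuotientGroup.rightRel (A.map π)
  let rep : H → H := fun h ↦ (Quotient.mk R h).out
  have rep_mul (a) (ha : a ∈ A) (h : H) : rep (π a * h) = rep h := by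
    refine congrArg Quotient.out (Quotient.sound (QuotientGroup.rightRel_apply.2 ?_))
    simpa using ⟨a, ha, rfl⟩
  have hrep (h : H) : ∃ a ∈ A, π a = h * (rep h)⁻¹ := by
    exact QuotientGroup.rightRel_apply.1 (Quotient.mk_out (s := R) h)
  choose β hβA hβ using hrep
  choose σ hσ using hπ
  have hs (a) (ha : a ∈ A) (h : H) : β (π a * h) = a * β h := by
    refine congrArg Subtype.val (hinj (a₁ := ⟨_, hβA _⟩) (a₂ := ⟨_, A.mul_mem ha (hβA h)⟩) ?_)
    simp [hβ, rep_mul a ha, mul_assoc]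
  refine ⟨fun h ↦ β h * σ (rep h) * (β 1 * σ (rep 1))⁻¹, fun h ↦ ?_, by simp, fun a ha h ↦ ?_⟩
  · simp [hβ, hσ]
  · simp only [rep_mul a ha, hs a ha, mul_assoc]

namespace IsAmalgamatedProduct

variable {A G H P : Type} [Group A] [Group G] [Group H] [Group P] {iG : A →* G} {iH : A →* H}
  {jG : G →* P} {jH : H →* P}

theorem eq_top_of_range_le (hP : IsAmalgamatedProduct iG iH jG jH) (S : Subgroup P)
    (hG : ∀ g, jG g ∈ S) (hH : ∀ h, jH h ∈ S) : S = ⊤ := by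
  obtain ⟨hcomm, huniv⟩ := hP
  obtain ⟨f, ⟨hfG, hfH⟩, -⟩ := huniv S (jG.codRestrict S hG) (jH.codRestrict S hH) (by
    ext a
    exact DFunLike.congr_fun hcomm a)
  have key : S.subtype.comp f = MonoidHom.id P := (huniv P jG jH hcomm).unique
    ⟨by rw [MonoidHom.comp_assoc, hfG]; rfl, by rw [MonoidHom.comp_assoc, hfH]; rfl⟩ ⟨rfl, rfl⟩
  refine eq_top_iff.2 fun p _ ↦ ?_
  have hp : (f p : P) = p := DFunLike.congr_fun key p
  exact hp ▸ (f p).2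

theorem countable [Countable G] [Countable H] (hP : IsAmalgamatedProduct iG iH jG jH) :
    Countable P := by
  have h : (Monoid.Coprod.lift jG jH).range = ⊤ := hP.eq_top_of_range_le _
    (fun g ↦ ⟨Monoid.Coprod.inl g, by simp⟩) fun h ↦ ⟨Monoid.Coprod.inr h, by simp⟩
  have : Countable (FreeMonoid (G ⊕ H)) := inferInstanceAs (Countable (List (G ⊕ H)))
  exact ((MonoidHom.range_eq_top.1 h).comp Monoid.Coprod.mk_surjective).countable

end IsAmalgamatedProduct

/-- The twisted Kaluzhnin-Krasner map attached to a section `s` of `π : G → H`, a homomorphism `κ`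
on the kernel of `π`, and a twist `u`. -/
def twistedKaluzhninKrasner {G H W : Type*} [Group G] [Group H] [Group W] (π : G →* H) (s : H → G)
    (hs : ∀ h, π (s h) = h) (κ : π.ker →* W) (u : H → W) : G →* W ≀ᵣ H where
  toFun g := ⟨fun y ↦ (u y)⁻¹ * κ ⟨(s y)⁻¹ * g * s ((π g)⁻¹ * y), by simp [MonoidHom.mem_ker, hs]⟩ *
    u ((π g)⁻¹ * y), π g⟩
  map_one' := by
    have κ_one (h : (1 : G) ∈ π.ker) : κ ⟨1, h⟩ = 1 := κ.map_one
    ext y <;> simp [κ_one]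
  map_mul' g g' := by
    ext y
    · simp only [map_mul, mul_inv_rev, RegularWreathProduct.mul_left, Pi.mul_apply, mul_assoc,
        mul_inv_cancel_left, mul_right_inj]
      simp only [← mul_assoc, ← map_mul, mul_left_inj]
      congr 2
      simp only [mul_assoc, mul_inv_cancel_left]
    · simp

/-- Theorem 1 / Proposition 2.1 (Moon, arXiv:1003.3998).
Let `H` be an amenable countable group, `π : G → H` a surjective homomorphism from a
countable group `G`, and `A ≤ G` a subgroup such that `π` is injective on `A` and
`π(A)` has index at least `2` in `H`. Then the amalgamated free product
`G ∗_A H` taken along the inclusion `A ↪ G` and `π|_A : A → H` is in the class `𝒜`. -/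
theorem amalgam_along_surjection_onto_amenable_mem_classA
    (G H : Type) [Group G] [Group H] [Countable G] [Countable H]
    (hH : AmenableGroup H)
    (π : G →* H) (hπ : Function.Surjective π)
    (A : Subgroup G) (hinj : Function.Injective (π.comp A.subtype))
    (hidx : Subgroup.map π A ≠ ⊤)
    (P : Type) [Group P] (jG : G →* P) (jH : H →* P)
    (hP : IsAmalgamatedProduct A.subtype (π.comp A.subtype) jG jH) :
    InClassA P := by
  have : Countable P := hP.countable
  obtain ⟨s, hs, hs₁, hsA⟩ := exists_equivariant_section hπ hinj
  obtain ⟨h₀, hh₀⟩ : ∃ h₀, h₀ ∉ A.map π := by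
    by_contra! h
    exact hidx (eq_top_iff.2 fun x _ ↦ h x)
  let R := QuotientGroup.rightRel (A.map π)
  let cl : H → Quotient R := Quotient.mk R
  have cl_eq {x y : H} : cl x = cl y ↔ y * x⁻¹ ∈ A.map π := by
    rw [← QuotientGroup.rightRel_apply]
    exact Quotient.eq
  have cl_mul (a) (ha : a ∈ A) (h : H) : cl ((π a)⁻¹ * h) = cl h :=
    cl_eq.2 (by simpa using ⟨a, ha, rfl⟩)
  have hne : cl h₀ ≠ cl 1 := by
    rw [ne_comm, Ne, cl_eq]
    simpa using hh₀
  obtain ⟨W, _, κ, u, hu₁, hψ, hgen, V, _, _, _, r, hκr, hur, hurs⟩ :=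
    exists_faithful_action_with_ray π.ker (Quotient R) (cl 1) (cl h₀) hne
  have hcomm (a) (ha : a ∈ A) : jG a = jH (π a) := DFunLike.congr_fun hP.1 ⟨a, ha⟩
  obtain ⟨ψ, hψκ, hψu⟩ : ∃ ψ : W →* P, (∀ k, ψ (κ k) = jG k) ∧
      ∀ h, ψ (u (cl h)) = (jG (s h))⁻¹ * jH h := by
    have hc {x y : H} (hxy : cl x = cl y) : (jG (s x))⁻¹ * jH x = (jG (s y))⁻¹ * jH y := by
      obtain ⟨a, ha, hay⟩ := cl_eq.1 hxy
      obtain rfl : y = π a * x := by rw [hay]; group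
      rw [hsA a ha, map_mul, map_mul, hcomm a ha]
      group
    obtain ⟨ψ, h₁, h₂⟩ := hψ P (jG.comp π.ker.subtype)
      (fun x ↦ (jG (s x.out))⁻¹ * jH x.out) (by
        rw [hc (y := 1) (Quotient.out_eq _), hs₁]
        simp)
    exact ⟨ψ, h₁, fun h ↦ (h₂ _).trans (hc (Quotient.out_eq _))⟩
  have κ_one (h : (1 : G) ∈ π.ker) : κ ⟨1, h⟩ = 1 := κ.map_one
  let fG : G →* W ≀ᵣ H := twistedKaluzhninKrasner π s hs κ fun h ↦ u (cl h)
  have fG_right (g) : (fG g).right = π g := rfl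
  have fG_left (g y) : (fG g).left y = (u (cl y))⁻¹ *
    κ ⟨(s y)⁻¹ * g * s ((π g)⁻¹ * y), by simp [MonoidHom.mem_ker, hs]⟩ *
      u (cl ((π g)⁻¹ * y)) := rfl
  obtain ⟨Λ, ⟨hΛG, hΛH⟩, -⟩ := hP.2 (W ≀ᵣ H) fG RegularWreathProduct.inl (by
    ext ⟨a, ha⟩ y
    · have hk : (s y)⁻¹ * a * s ((π a)⁻¹ * y) = 1 := by
        have := hsA _ (A.inv_mem ha) y
        rw [map_inv] at this
        rw [this]
        group
      simp [fG_left, hk, cl_mul a ha, κ_one]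
    · simp [fG_right])
  replace hΛG (g) : Λ (jG g) = fG g := DFunLike.congr_fun hΛG g
  replace hΛH (h) : Λ (jH h) = RegularWreathProduct.inl h := DFunLike.congr_fun hΛH h
  have hΛ (p : P) (h : H) :
      p * jH h = jH ((Λ p).right * h) * ψ ((Λ p).left ((Λ p).right * h)) := by
    let S : Subgroup P :=
      { carrier := {p | ∀ h, p * jH h = jH ((Λ p).right * h) * ψ ((Λ p).left ((Λ p).right * h))}
        one_mem' := by simp
        mul_mem' := fun {p q} hp hq h ↦ by
          rw [mul_assoc, hq, ← mul_assoc, hp]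
          simp [mul_assoc]
        inv_mem' := fun {p} hp h ↦ by
          have := hp ((Λ p).right⁻¹ * h)
          rw [mul_inv_cancel_left] at this
          rw [inv_mul_eq_iff_eq_mul, map_inv, RegularWreathProduct.inv_right, ← mul_assoc, this]
          simp [mul_assoc] }
    have hS : S = ⊤ := by
      refine hP.eq_top_of_range_le S (fun g h ↦ ?_) fun h' h ↦ ?_
      · simp [hΛG, fG_left, fG_right, hψκ, hψu, mul_assoc]
      · simp [hΛH]
    exact (hS ▸ Subgroup.mem_top p : p ∈ S) h
  have Λ_inj : Function.Injective Λ := by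
    refine (injective_iff_map_eq_one _).2 fun p hp ↦ ?_
    simpa [hp] using hΛ p 1
  let T : Subgroup W :=
    { carrier := {w | ∃ p, (Λ p).right = 1 ∧ (Λ p).left 1 = w}
      one_mem' := ⟨1, by simp⟩
      mul_mem' := by
        rintro _ _ ⟨p, hp, rfl⟩ ⟨q, hq, rfl⟩
        exact ⟨p * q, by simp [hp, hq]⟩
      inv_mem' := by
        rintro _ ⟨p, hp, rfl⟩
        exact ⟨p⁻¹, by simp [hp]⟩ }
  have hT : T = ⊤ := by
    refine hgen T (fun k ↦ ?_) fun x ↦ ?_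
    · have hk : π k = 1 := k.2
      exact ⟨jG k, by simp [hΛG, fG_right, hk], by simp [hΛG, fG_left, hk, hs₁, hu₁]⟩
    · obtain ⟨h, rfl⟩ := Quotient.exists_rep x
      refine ⟨(jG (s h))⁻¹ * jH h, ?_, ?_⟩
      · simp [hΛG, hΛH, fG_right, hs]
      · change _ = u (cl h)
        simp [hΛG, hΛH, fG_left, fG_right, hs, hs₁, hu₁, κ_one]
  let φ : P →* Equiv.Perm (V × H) := (RegularWreathProduct.toPerm W H V).comp Λ
  have hφ (p : P) (x : V × H) :
      φ p x = ((Λ p).left ((Λ p).right * x.2) • x.1, (Λ p).right * x.2) := rfl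
  have φ_inj : Function.Injective φ :=
    have : Nonempty V := ⟨r 0⟩
    (RegularWreathProduct.toPermInj W H V).comp Λ_inj
  have base (x : V × H) : ∃ p, φ p (r 0, 1) = x := by
    obtain ⟨w, hw⟩ := MulAction.exists_smul_eq W (r 0) x.1
    obtain ⟨p, hp₁, hp₂⟩ : w ∈ T := hT ▸ Subgroup.mem_top w
    exact ⟨jH x.2 * p, by simp [hφ, hΛH, hp₁, hp₂, hw]⟩
  obtain ⟨μ, μ_nonneg, μ_univ, μ_union, μ_right, μ_shift⟩ :=
    exists_mean_prod hH r {h | cl h = cl h₀}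
  let I : Subgroup (Equiv.Perm (V × H)) :=
    { carrier := {e | ∀ S, μ (e ⁻¹' S) = μ S}
      one_mem' := fun S ↦ rfl
      mul_mem' := fun {e e'} he he' S ↦ by
        rw [Equiv.Perm.coe_mul, Set.preimage_comp, he', he]
      inv_mem' := fun {e} he S ↦ by
        rw [← he, ← Set.preimage_comp, ← Equiv.Perm.coe_mul, inv_mul_cancel]
        rfl }
  let τ : Equiv.Perm (V × H) := RegularWreathProduct.toPerm W H V ⟨fun h ↦ u (cl h), 1⟩
  have hτ (x : V × H) : τ x = (u (cl x.2) • x.1, x.2) := by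
    change (u (cl (1 * x.2)) • x.1, 1 * x.2) = _
    rw [one_mul]
  have hτI : τ ∈ I := by
    refine μ_shift τ (fun i q hq ↦ ?_) fun i q hq ↦ ?_
    · rw [hτ, hur _ hq]
    · rw [hτ, show cl q = cl h₀ from hq, hurs]
  have hI : I.comap φ = ⊤ := by
    refine hP.eq_top_of_range_le _ (fun g ↦ ?_) fun h ↦ ?_
    · have conj : τ * φ (jG g) * τ⁻¹ ∈ I := by
        refine μ_right _ (π g) fun i q ↦ ?_
        have : τ⁻¹ (r i, q) = ((u (cl q))⁻¹ • r i, q) := by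
          rw [Equiv.Perm.inv_eq_iff_eq, hτ]
          simp
        rw [Equiv.Perm.mul_apply, Equiv.Perm.mul_apply, this]
        simp [hτ, hφ, hΛG, fG_left, fG_right, smul_smul, mul_assoc, hκr]
      simpa [mul_assoc] using I.mul_mem (I.mul_mem (I.inv_mem hτI) conj) hτI
    · exact μ_right _ h fun i q ↦ by simp [hφ, hΛH]
  refine ⟨V × H, ?_, φ, φ_inj, fun x y ↦ ?_, μ, μ_nonneg, μ_univ, μ_union, fun p S ↦ ?_⟩
  · exact Function.Surjective.countable base
  · obtain ⟨p, rfl⟩ := base x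
    obtain ⟨q, rfl⟩ := base y
    exact ⟨q * p⁻¹, by simp⟩
  · have hp : φ p ∈ I := (hI ▸ Subgroup.mem_top p : p ∈ I.comap φ)
    rw [← hp, Set.preimage_image_eq _ (φ p).injective]
end

section
/- Let G and H be countable groups and let A be a common finite subgroup of G and H. If G is an infinite amenable group and there exists a countable set Y with an H-action that is amenable and on which the restricted action of A is free, then the amalgamated free product G ∗_A H belongs to the class 𝒜. -/
namespace AmalgamClassA

open scoped Pointwise Classical Finset

/-- A finitely additive probability measure defined on all subsets of `X`. -/
structure IsFinitelyAdditive {X : Type*} (μ : Set X → ℝ) : Prop where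
  nonneg : ∀ S, 0 ≤ μ S
  univ : μ Set.univ = 1
  union : ∀ S T, Disjoint S T → μ (S ∪ T) = μ S + μ T

namespace IsFinitelyAdditive

variable {X : Type*} {μ : Set X → ℝ}

lemma empty (h : IsFinitelyAdditive μ) : μ ∅ = 0 := by
  simpa using h.union ∅ ∅ (by simp)

lemma mono (h : IsFinitelyAdditive μ) {S T : Set X} (hST : S ⊆ T) : μ S ≤ μ T := by
  have := h.union S (T \ S) Set.disjoint_sdiff_right
  rw [Set.union_sdiff_cancel hST] at this
  linarith [h.nonneg (T \ S)]

lemma biUnion (h : IsFinitelyAdditive μ) {ι : Type*} (s : Finset ι) (f : ι → Set X)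
    (hf : (s : Set ι).PairwiseDisjoint f) : μ (⋃ i ∈ s, f i) = ∑ i ∈ s, μ (f i) := by
  induction s using Finset.induction_on with
  | empty => simpa using h.empty
  | insert a s ha ih =>
    rw [Finset.coe_insert, Set.pairwiseDisjoint_insert_of_notMem (by simpa using ha)] at hf
    rw [Finset.set_biUnion_insert, Finset.sum_insert ha, h.union _ _ ?_, ih hf.1]
    exact Set.disjoint_iUnion₂_right.2 fun i hi => hf.2 i hi

lemma eq_of_null_diff (h : IsFinitelyAdditive μ) {S T : Set X} (hS : μ (S \ T) = 0)
    (hT : μ (T \ S) = 0) : μ S = μ T := by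
  have h1 := h.union (S ∩ T) (S \ T) Set.disjoint_sdiff_inter.symm
  have h2 := h.union (T ∩ S) (T \ S) Set.disjoint_sdiff_inter.symm
  rw [Set.inter_union_sdiff] at h1 h2
  rw [h1, h2, Set.inter_comm, hS, hT]

end IsFinitelyAdditive

section Folner

variable {K W : Type*} [Group K] [MulAction K W]

lemma amenableAction_iff : AmenableAction (MulAction.toPermHom K W) ↔
    ∃ μ : Set W → ℝ, IsFinitelyAdditive μ ∧ ∀ (g : K) S, μ (g • S) = μ S :=
  ⟨fun ⟨μ, h1, h2, h3, h4⟩ => ⟨μ, ⟨h1, h2, h3⟩, h4⟩, fun ⟨μ, h, h4⟩ => ⟨μ, h.1, h.2, h.3, h4⟩⟩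

lemma mean_range_eq_one {μ : Set W → ℝ} (hμ : IsFinitelyAdditive μ)
    (hinv : ∀ (g : K) S, μ (g • S) = μ S) (T : Finset K) (f : W → W)
    (hf : Function.Injective f) (t : W → K) (ht : ∀ x, t x ∈ T) (hft : ∀ x, f x = t x • x) :
    μ (Set.range f) = 1 := by
  have h1 : (⋃ k ∈ T, t ⁻¹' {k}) = Set.univ := by
    ext x; simp [ht]
  have h2 : Set.range f = ⋃ k ∈ T, k • (t ⁻¹' {k}) := by
    ext y
    simp only [Set.mem_range, Set.mem_iUnion, Set.mem_smul_set, Set.mem_preimage,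
      Set.mem_singleton_iff, exists_prop]
    constructor
    · rintro ⟨x, rfl⟩
      exact ⟨t x, ht x, x, rfl, (hft x).symm⟩
    · rintro ⟨k, -, x, rfl, rfl⟩
      exact ⟨x, hft x⟩
  rw [h2, hμ.biUnion]
  · simp only [hinv]
    rw [← hμ.biUnion, h1, hμ.univ]
    exact fun i _ j _ hij => (Set.disjoint_singleton.2 hij).preimage t
  · intro i _ j _ hij
    refine Set.disjoint_left.2 ?_
    rintro _ ⟨x, rfl, rfl⟩ ⟨y, rfl, hxy⟩
    simp only [← hft] at hxy
    exact hij (congrArg t (hf hxy)).symm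

/-- An amenable action admits no uniform doubling: this is the easy half of Tarski's alternative,
obtained from Hall's marriage theorem. -/
lemma exists_card_smul_lt (h : AmenableAction (MulAction.toPermHom K W)) (T : Finset K) :
    ∃ F : Finset W, #(T • F) < 2 * #F := by
  by_contra! hT
  obtain ⟨μ, hμ, hinv⟩ := amenableAction_iff.1 h
  obtain ⟨f, hf, hfT⟩ := (Finset.all_card_le_biUnion_card_iff_exists_injective
    (fun p : W × Bool => T • ({p.1} : Finset W))).1 (fun s => by
      have h1 : s ⊆ s.image Prod.fst ×ˢ Finset.univ := fun p hp =>
        Finset.mem_product.2 ⟨Finset.mem_image_of_mem _ hp, Finset.mem_univ _⟩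
      have h2 := Finset.card_le_card h1
      rw [Finset.card_product, Finset.card_univ, Fintype.card_bool, mul_comm] at h2
      refine (h2.trans (hT _)).trans (Finset.card_le_card ?_)
      intro y hy
      obtain ⟨k, hk, x, hx, rfl⟩ := Finset.mem_smul.1 hy
      obtain ⟨p, hp, rfl⟩ := Finset.mem_image.1 hx
      exact Finset.mem_biUnion.2 ⟨p, hp, Finset.smul_mem_smul hk (by simp)⟩)
  have hft : ∀ p, ∃ k ∈ T, f p = k • p.1 := fun p => by
    obtain ⟨k, hk, x, hx, hy⟩ := Finset.mem_smul.1 (hfT p)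
    rw [Finset.mem_singleton] at hx
    exact ⟨k, hk, by rw [← hy, hx]⟩
  choose t ht hft using hft
  have key (b : Bool) : μ (Set.range fun x => f (x, b)) = 1 :=
    mean_range_eq_one hμ hinv T _ (fun x y hxy => (Prod.ext_iff.1 (hf hxy)).1)
      (fun x => t (x, b)) (fun x => ht _) (fun x => hft _)
  have hd : Disjoint (Set.range fun x => f (x, true)) (Set.range fun x => f (x, false)) := by
    refine Set.disjoint_left.2 ?_
    rintro _ ⟨x, rfl⟩ ⟨y, hy⟩
    simpa using (Prod.ext_iff.1 (hf hy)).2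
  have h1 := hμ.union _ _ hd
  have h2 := hμ.mono (Set.subset_univ
    ((Set.range fun x => f (x, true)) ∪ (Set.range fun x => f (x, false))))
  rw [hμ.univ, h1, key, key] at h2
  norm_num at h2

lemma two_mul_pow_le (n : ℕ) (hn : 0 < n) : 2 * n ^ n ≤ (n + 1) ^ n := by
  have h : ∀ k, n ^ k * (n + k) ≤ n * (n + 1) ^ k := by
    intro k
    induction k with
    | zero => simp
    | succ k ih =>
      calc n ^ (k + 1) * (n + (k + 1)) ≤ n ^ k * (n + k) * (n + 1) := by
            rw [pow_succ, mul_assoc, mul_assoc]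
            exact Nat.mul_le_mul_left _ (by nlinarith)
        _ ≤ n * (n + 1) ^ k * (n + 1) := Nat.mul_le_mul_right _ ih
        _ = _ := by ring
  refine Nat.le_of_mul_le_mul_left ?_ hn
  calc n * (2 * n ^ n) = n ^ n * (n + n) := by ring
    _ ≤ _ := h n

/-- Small growth under multiplication by a fixed finite set. -/
lemma exists_card_smul_le (h : AmenableAction (MulAction.toPermHom K W)) (S : Finset K) (n : ℕ) :
    ∃ F : Finset W, F.Nonempty ∧ n * #(S • F) ≤ (n + 1) * #F := by
  obtain ⟨F, hF⟩ := exists_card_smul_lt h (S ^ n)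
  by_contra! hS
  have hFne : F.Nonempty := by
    rw [← Finset.card_pos]; omega
  have hn : 0 < n := by
    rcases Nat.eq_zero_or_pos n with rfl | hn
    · simpa using hS F hFne
    · exact hn
  have hpow : ∀ k, (S ^ k • F).Nonempty ∧ (n + 1) ^ k * #F ≤ n ^ k * #(S ^ k • F) := by
    intro k
    induction k with
    | zero => simpa using hFne
    | succ k ih =>
      have h1 := hS _ ih.1
      rw [← mul_smul, ← pow_succ'] at h1
      constructor
      · rw [← Finset.card_pos]
        by_contra! h0
        rw [Nat.le_zero.1 h0] at h1
        omega
      · calc (n + 1) ^ (k + 1) * #F = (n + 1) * ((n + 1) ^ k * #F) := by ring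
          _ ≤ (n + 1) * (n ^ k * #(S ^ k • F)) := Nat.mul_le_mul_left _ ih.2
          _ = n ^ k * ((n + 1) * #(S ^ k • F)) := by ring
          _ ≤ n ^ k * (n * #(S ^ (k + 1) • F)) := Nat.mul_le_mul_left _ h1.le
          _ = _ := by ring
  have h1 := (hpow n).2
  have h2 := two_mul_pow_le n hn
  have h3 : n ^ n * #(S ^ n • F) < n ^ n * (2 * #F) :=
    Nat.mul_lt_mul_of_pos_left hF (by positivity)
  nlinarith [Nat.mul_le_mul_right #F h2]

variable {A : Type*} [Group A]

/-- `E` is `A`-invariant and is moved by each element of `S` by a proportion at most `1 / n`. -/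
def IsFolner (i : A →* K) (S : Finset K) (n : ℕ) (E : Finset W) : Prop :=
  (∀ a, i a • E = E) ∧ ∀ s ∈ S, n * #(s • E \ E) ≤ #E

lemma exists_isFolner [Finite A] (h : AmenableAction (MulAction.toPermHom K W)) (i : A →* K)
    (S : Finset K) (n : ℕ) : ∃ E : Finset W, E.Nonempty ∧ IsFolner i S n E := by
  have := Fintype.ofFinite A
  set B : Finset K := Finset.univ.image i
  have hB1 : (1 : K) ∈ B := Finset.mem_image.2 ⟨1, by simp⟩
  obtain ⟨F, hF, hFc⟩ := exists_card_smul_le h (insert 1 S * B) n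
  rw [mul_smul] at hFc
  have hFB : F ⊆ B • F := fun x hx => by simpa using Finset.smul_mem_smul hB1 hx
  refine ⟨B • F, hF.mono hFB, fun a => ?_, fun s hs => ?_⟩
  · refine Finset.eq_of_subset_of_card_le ?_ (by rw [Finset.card_smul_finset])
    intro x hx
    obtain ⟨y, hy, rfl⟩ := Finset.mem_smul_finset.1 hx
    obtain ⟨b, hb, z, hz, rfl⟩ := Finset.mem_smul.1 hy
    obtain ⟨a', -, rfl⟩ := Finset.mem_image.1 hb
    rw [smul_smul, ← map_mul]
    exact Finset.smul_mem_smul (Finset.mem_image_of_mem _ (Finset.mem_univ _)) hz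
  · have h1 : B • F ⊆ insert 1 S • (B • F) := fun x hx => by
      simpa using Finset.smul_mem_smul (Finset.mem_insert_self 1 S) hx
    have h2 : s • (B • F) \ (B • F) ⊆ (insert 1 S • (B • F)) \ (B • F) :=
      Finset.sdiff_subset_sdiff (Finset.smul_finset_subset_smul (by simp [hs])) le_rfl
    have h3 := Finset.card_le_card h2
    rw [Finset.card_sdiff_of_subset h1] at h3
    have h4 := Finset.card_le_card h1
    have h5 := Finset.card_le_card hFB
    have h6 := Nat.mul_le_mul_left n h3
    rw [Nat.mul_sub] at h6
    have h7 := Nat.mul_le_mul_left n h5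
    have h8 : n * #(B • F) + #F ≤ n * #(B • F) + #(B • F) := by omega
    have : (n + 1) * #F = n * #F + #F := by ring
    omega

lemma IsFolner.union {i : A →* K} {S : Finset K} {n : ℕ} {E F : Finset W}
    (hE : IsFolner i S n E) (hF : IsFolner i S n F) (h : Disjoint E F) :
    IsFolner i S n (E ∪ F) := by
  refine ⟨fun a => by rw [Finset.smul_finset_union, hE.1, hF.1], fun s hs => ?_⟩
  have h1 : s • (E ∪ F) \ (E ∪ F) ⊆ (s • E \ E) ∪ (s • F \ F) := by
    rw [Finset.smul_finset_union]
    intro x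
    simp only [Finset.mem_sdiff, Finset.mem_union]
    tauto
  have h2 := (Finset.card_le_card h1).trans (Finset.card_union_le _ _)
  have h3 := Nat.mul_le_mul_left n h2
  rw [Finset.card_union_of_disjoint h]
  have := hE.2 s hs
  have := hF.2 s hs
  linarith

lemma IsFolner.mono {i : A →* K} {S T : Finset K} {m n : ℕ} {E : Finset W}
    (hE : IsFolner i T n E) (hS : S ⊆ T) (hmn : m ≤ n) : IsFolner i S m E :=
  ⟨hE.1, fun s hs => (Nat.mul_le_mul_right _ hmn).trans (hE.2 s (hS hs))⟩

variable (W) in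
/-- For all `S` and `n` there are Følner sets of a common cardinality avoiding any
given finite set. -/
def IsRich (i : A →* K) : Prop :=
  ∀ (S : Finset K) (n : ℕ), ∃ m > 0, ∀ U : Finset W, ∃ E : Finset W,
    Disjoint E U ∧ #E = m ∧ IsFolner i S n E

lemma exists_isFolner_card_mul {i : A →* K} {S : Finset K} {n m : ℕ}
    (h : ∀ U : Finset W, ∃ E : Finset W, Disjoint E U ∧ #E = m ∧ IsFolner i S n E)
    (k : ℕ) (U : Finset W) :
    ∃ E : Finset W, Disjoint E U ∧ #E = k * m ∧ IsFolner i S n E := by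
  induction k with
  | zero => exact ⟨∅, by simp [IsFolner]⟩
  | succ k ih =>
    obtain ⟨E, hE, hEc, hEF⟩ := ih
    obtain ⟨F, hF, hFc, hFF⟩ := h (E ∪ U)
    rw [Finset.disjoint_union_right] at hF
    refine ⟨E ∪ F, Finset.disjoint_union_left.2 ⟨hE, hF.2⟩, ?_, hEF.union hFF hF.1.symm⟩
    rw [Finset.card_union_of_disjoint hF.1.symm, hEc, hFc]
    ring

lemma IsFolner.map {V : Type*} [MulAction K V] {i : A →* K} {S : Finset K} {n : ℕ} {E : Finset W}
    (hE : IsFolner i S n E) (f : W ↪ V) (hf : ∀ (k : K) w, f (k • w) = k • f w) :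
    IsFolner i S n (E.map f) := by
  have hs (k : K) : k • E.map f = (k • E).map f := by
    ext x; simp [Finset.mem_smul_finset, hf]
  refine ⟨fun a => by rw [hs, hE.1], fun s hsS => ?_⟩
  rw [hs, ← Finset.map_sdiff, Finset.card_map, Finset.card_map]
  exact hE.2 s hsS

lemma isRich_self [Finite A] [Infinite K] (h : AmenableGroup K) (i : A →* K) : IsRich K i := by
  intro S n
  obtain ⟨E, hE, hEF⟩ := exists_isFolner h i S n
  refine ⟨#E, hE.card_pos, fun U => ?_⟩
  obtain ⟨g, hg⟩ := Infinite.exists_notMem_finset (E⁻¹ * U)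
  refine ⟨E.map (mulRightEmbedding g), ?_, Finset.card_map _,
    hEF.map _ fun k w => by simp [mul_assoc]⟩
  refine Finset.disjoint_left.2 fun x hx hxU => hg ?_
  obtain ⟨e, he, rfl⟩ := Finset.mem_map.1 hx
  exact Finset.mem_mul.2 ⟨e⁻¹, Finset.inv_mem_inv he, _, hxU, by simp⟩

lemma isRich_sigma_sum [Finite A] (h : AmenableAction (MulAction.toPermHom K W)) (i : A →* K)
    (V : Type*) [MulAction K V] : IsRich (Σ _ : ℕ, W ⊕ V) i := by
  intro S n
  obtain ⟨E, hE, hEF⟩ := exists_isFolner h i S n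
  refine ⟨#E, hE.card_pos, fun U => ?_⟩
  obtain ⟨j, hj⟩ := Infinite.exists_notMem_finset (U.image Sigma.fst)
  refine ⟨E.map (Function.Embedding.inl.trans (Function.Embedding.sigmaMk (β := fun _ => W ⊕ V) j)),
    ?_, Finset.card_map _, hEF.map _ fun k w => rfl⟩
  refine Finset.disjoint_left.2 fun x hx hxU => hj ?_
  obtain ⟨e, he, rfl⟩ := Finset.mem_map.1 hx
  exact Finset.mem_image.2 ⟨_, hxU, rfl⟩

end Folner

/-- Two rich actions admit simultaneous sequences of pairwise disjoint Følner sets of equal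
cardinalities. -/
lemma exists_matching_folner_sequences {A K L V W : Type*} [Group A] [Group K] [Group L]
    [Countable K] [Countable L] [MulAction K V] [MulAction L W] {i : A →* K} {j : A →* L}
    (hV : IsRich V i) (hW : IsRich W j) :
    ∃ (E : ℕ → Finset V) (F : ℕ → Finset W), (∀ n, #(E n) = #(F n)) ∧ (∀ n, (E n).Nonempty) ∧
      Pairwise (Function.onFun Disjoint E) ∧ Pairwise (Function.onFun Disjoint F) ∧
      (∀ n a, i a • E n = E n) ∧ (∀ n a, j a • F n = F n) ∧
      (∀ (k : K) (N : ℕ), ∀ᶠ n in Filter.atTop, N * #(k • E n \ E n) ≤ #(E n)) ∧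
      (∀ (l : L) (N : ℕ), ∀ᶠ n in Filter.atTop, N * #(l • F n \ F n) ≤ #(F n)) := by
  obtain ⟨eK, heK⟩ := exists_surjective_nat K
  obtain ⟨eL, heL⟩ := exists_surjective_nat L
  obtain ⟨f, hfP, hfr⟩ := exists_seq_of_forall_finset_exists
    (fun p : ℕ × Finset V × Finset W => #p.2.1 = #p.2.2 ∧ p.2.1.Nonempty ∧
      IsFolner i ((Finset.range p.1).image eK) p.1 p.2.1 ∧
      IsFolner j ((Finset.range p.1).image eL) p.1 p.2.2)
    (fun p q => p.1 < q.1 ∧ Disjoint p.2.1 q.2.1 ∧ Disjoint p.2.2 q.2.2) (fun s _ => by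
      obtain ⟨n, hn⟩ := Infinite.exists_notMem_finset (Finset.range ((s.sup Prod.fst) + 1))
      obtain ⟨m, hm, hmE⟩ := hV ((Finset.range n).image eK) n
      obtain ⟨m', hm', hmF⟩ := hW ((Finset.range n).image eL) n
      obtain ⟨E, hE, hEc, hEF⟩ := exists_isFolner_card_mul hmE m' (s.biUnion fun p => p.2.1)
      obtain ⟨F, hF, hFc, hFF⟩ := exists_isFolner_card_mul hmF m (s.biUnion fun p => p.2.2)
      refine ⟨(n, E, F), ⟨?_, ?_, hEF, hFF⟩, fun p hp => ⟨?_, ?_, ?_⟩⟩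
      · rw [hEc, hFc, mul_comm]
      · rw [← Finset.card_pos, hEc]
        positivity
      · have := Finset.le_sup (f := Prod.fst) hp
        rw [Finset.mem_range] at hn
        simp only
        omega
      · exact ((Finset.disjoint_biUnion_right _ _ _).1 hE p hp).symm
      · exact ((Finset.disjoint_biUnion_right _ _ _).1 hF p hp).symm)
  have hmono : StrictMono fun n => (f n).1 := fun m n hmn => (hfr m n hmn).1
  have hev (N : ℕ) : ∀ᶠ n in Filter.atTop, N < (f n).1 :=
    hmono.tendsto_atTop.eventually_gt_atTop N
  refine ⟨fun n => (f n).2.1, fun n => (f n).2.2, fun n => (hfP n).1, fun n => (hfP n).2.1,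
    ?_, ?_, fun n => (hfP n).2.2.1.1, fun n => (hfP n).2.2.2.1, fun k N => ?_, fun l N => ?_⟩
  · intro m n hmn
    rcases hmn.lt_or_gt with h | h
    · exact (hfr m n h).2.1
    · exact (hfr n m h).2.1.symm
  · intro m n hmn
    rcases hmn.lt_or_gt with h | h
    · exact (hfr m n h).2.2
    · exact (hfr n m h).2.2.symm
  · obtain ⟨m, rfl⟩ := heK k
    filter_upwards [hev m, hev N] with n h1 h2
    exact (Nat.mul_le_mul_right _ h2.le).trans
      ((hfP n).2.2.1.2 _ (Finset.mem_image_of_mem _ (Finset.mem_range.2 h1)))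
  · obtain ⟨m, rfl⟩ := heL l
    filter_upwards [hev m, hev N] with n h1 h2
    exact (Nat.mul_le_mul_right _ h2.le).trans
      ((hfP n).2.2.2.2 _ (Finset.mem_image_of_mem _ (Finset.mem_range.2 h1)))

/-- Ultralimits of normalized counting measures: the mean obtained is invariant under every
permutation for which the given sets are asymptotically invariant. -/
lemma exists_mean_of_folner {W : Type*} (E : ℕ → Finset W) (hE : ∀ n, (E n).Nonempty) :
    ∃ μ : Set W → ℝ, IsFinitelyAdditive μ ∧ ∀ π : Equiv.Perm W,
      (∀ N : ℕ, ∀ᶠ n in Filter.atTop, N * #((E n).map π.toEmbedding \ E n) ≤ #(E n)) →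
      ∀ S, μ (π '' S) = μ S := by
  set d : Set W → ℕ → ℝ := fun S n => #{x ∈ E n | x ∈ S} / #(E n) with hd
  have hpos (n : ℕ) : (0 : ℝ) < #(E n) := by exact_mod_cast (hE n).card_pos
  have hd01 (S : Set W) (n : ℕ) : d S n ∈ Set.Icc (0 : ℝ) 1 :=
    ⟨by positivity, div_le_one_of_le₀ (by exact_mod_cast Finset.card_filter_le _ _) (hpos n).le⟩
  set U := Filter.hyperfilter ℕ
  have hU : (U : Filter ℕ) ≤ Filter.atTop := by
    rw [← Nat.cofinite_eq_atTop]; exact Filter.hyperfilter_le_cofinite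
  have hlim (S : Set W) : ∃ x ∈ Set.Icc (0 : ℝ) 1, Filter.Tendsto (d S) U (nhds x) :=
    isCompact_Icc.ultrafilter_le_nhds (U.map (d S))
      (Filter.le_principal_iff.2 (Filter.mem_map.2 (Filter.Eventually.of_forall (hd01 S))))
  choose μ hμ hμlim using hlim
  refine ⟨μ, ⟨fun S => (hμ S).1, ?_, fun S T hST => ?_⟩, fun π hπ S => ?_⟩
  · refine tendsto_nhds_unique (hμlim _) (tendsto_const_nhds.congr fun n => ?_)
    simp [hd, (hpos n).ne']
  · refine tendsto_nhds_unique (hμlim _) (((hμlim S).add (hμlim T)).congr fun n => ?_)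
    simp only [hd]
    rw [← add_div, ← Nat.cast_add, ← Finset.card_union_of_disjoint, ← Finset.filter_or]
    · simp only [Set.mem_union]
    · exact Finset.disjoint_filter.2 fun x _ hx hx' => Set.disjoint_left.1 hST hx hx'
  · have hbound (n : ℕ) : |d (π '' S) n - d S n| ≤
        #((E n).map π.toEmbedding \ E n) / #(E n) := by
      simp only [hd]
      rw [← sub_div, abs_div, abs_of_pos (hpos n)]
      refine div_le_div_of_nonneg_right ?_ (hpos n).le
      have hcard : #((E n).map π.toEmbedding \ E n) = #(E n \ (E n).map π.toEmbedding) := by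
        have h1 := Finset.card_sdiff_add_card_inter ((E n).map π.toEmbedding) (E n)
        have h2 := Finset.card_sdiff_add_card_inter (E n) ((E n).map π.toEmbedding)
        rw [Finset.inter_comm, Finset.card_map] at h1
        omega
      have hmap : #{x ∈ E n | x ∈ S} = #{x ∈ (E n).map π.toEmbedding | x ∈ π '' S} := by
        rw [Finset.filter_map, Finset.card_map]
        simp
      have h1 : {x ∈ E n | x ∈ π '' S} ⊆ {x ∈ (E n).map π.toEmbedding | x ∈ π '' S} ∪
          (E n \ (E n).map π.toEmbedding) := by
        intro x; simp only [Finset.mem_union, Finset.mem_filter, Finset.mem_sdiff]; tauto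
      have h2 : {x ∈ (E n).map π.toEmbedding | x ∈ π '' S} ⊆ {x ∈ E n | x ∈ π '' S} ∪
          ((E n).map π.toEmbedding \ E n) := by
        intro x; simp only [Finset.mem_union, Finset.mem_filter, Finset.mem_sdiff]; tauto
      have h3 := (Finset.card_le_card h1).trans (Finset.card_union_le _ _)
      have h4 := (Finset.card_le_card h2).trans (Finset.card_union_le _ _)
      rw [← hmap, ← hcard] at h3
      rw [← hmap] at h4
      rw [abs_sub_le_iff, sub_le_iff_le_add', sub_le_iff_le_add']
      exact ⟨by exact_mod_cast h3, by exact_mod_cast h4⟩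
    have hzero : Filter.Tendsto (fun n => d (π '' S) n - d S n) U (nhds 0) := by
      refine Filter.Tendsto.mono_left ?_ hU
      rw [Metric.tendsto_nhds]
      intro ε hε
      obtain ⟨N, hN⟩ := exists_nat_gt (1 / ε)
      filter_upwards [hπ N] with n hn
      rw [Real.dist_eq, sub_zero]
      refine (hbound n).trans_lt ?_
      rw [div_lt_iff₀ (hpos n)]
      have h1 : (N : ℝ) * #((E n).map π.toEmbedding \ E n) ≤ #(E n) := by exact_mod_cast hn
      rw [div_lt_iff₀ hε] at hN
      have hN0 : (0 : ℝ) < N := by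
        by_contra! h0
        nlinarith
      have h2 : (0 : ℝ) < N * ε * #(E n) - #(E n) := by nlinarith [hpos n]
      refine lt_of_mul_lt_mul_left (a := (N : ℝ)) ?_ hN0.le
      nlinarith
    exact sub_eq_zero.1 (tendsto_nhds_unique ((hμlim _).sub (hμlim _)) hzero)

/-- A free `A`-set is isomorphic to the product of its set of orbits with `A`. -/
lemma exists_equiv_orbits_prod {A V : Type*} [Group A] [MulAction A V]
    (hV : ∀ (a : A) (v : V), a • v = v → a = 1) :
    ∃ e : MulAction.orbitRel.Quotient A V × A ≃ V, ∀ q a, e (q, a) = a • e (q, 1) := by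
  have hmk (q : MulAction.orbitRel.Quotient A V) (a : A) :
      (Quotient.mk'' (a • q.out) : MulAction.orbitRel.Quotient A V) = q := by
    conv_rhs => rw [← Quotient.out_eq' q]
    exact Quotient.sound' (MulAction.mem_orbit _ a)
  refine ⟨Equiv.ofBijective (fun p => p.2 • p.1.out) ⟨?_, ?_⟩, fun q a => ?_⟩
  · rintro ⟨p, a⟩ ⟨q, b⟩ hpq
    simp only at hpq
    obtain rfl : p = q := by rw [← hmk p a, hpq, hmk]
    have := hV (b⁻¹ * a) p.out (by rw [mul_smul, hpq, inv_smul_smul])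
    rw [inv_mul_eq_one.1 this]
  · intro v
    have h : MulAction.orbitRel A V
        (Quotient.mk'' v : MulAction.orbitRel.Quotient A V).out v :=
      Quotient.exact' (Quotient.out_eq' _)
    obtain ⟨a, ha⟩ := h
    exact ⟨(Quotient.mk'' v, a⁻¹), by simp [← ha]⟩
  · exact congrArg (a • ·) (one_smul A q.out).symm

lemma nonempty_equiv_of_prod_equiv {A P Q : Type*} [Finite A] [Nonempty A] [Countable P]
    [Countable Q] (e : P × A ≃ Q × A) : Nonempty (P ≃ Q) := by
  rcases finite_or_infinite P with hP | hP
  · have : Finite (Q × A) := Finite.of_equiv _ e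
    have : Finite Q := Finite.of_surjective _ (Prod.fst_surjective (α := Q) (β := A))
    have h := Nat.card_congr e
    rw [Nat.card_prod, Nat.card_prod] at h
    exact Finite.card_eq.1 (Nat.eq_of_mul_eq_mul_right Nat.card_pos h)
  · have : Infinite Q := by
      by_contra hQ
      rw [not_infinite_iff_finite] at hQ
      have : Finite (P × A) := Finite.of_equiv _ e.symm
      exact not_finite (P × A)
    infer_instance

/-- Free actions of a finite group with equinumerous pieces are equivariantly isomorphic, by an
isomorphism respecting the pieces. -/
lemma exists_equivariant_equiv {A V W ι : Type*} [Group A] [Finite A] [MulAction A V]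
    [MulAction A W] [Countable V] [Countable W] (hV : ∀ (a : A) (v : V), a • v = v → a = 1)
    (hW : ∀ (a : A) (w : W), a • w = w → a = 1) (c : V → ι) (c' : W → ι)
    (hc : ∀ (a : A) v, c (a • v) = c v) (hc' : ∀ (a : A) w, c' (a • w) = c' w)
    (h : ∀ y, Nonempty ({v // c v = y} ≃ {w // c' w = y})) :
    ∃ σ : V ≃ W, (∀ (a : A) v, σ (a • v) = a • σ v) ∧ ∀ v, c' (σ v) = c v := by
  obtain ⟨e, he⟩ := exists_equiv_orbits_prod hV
  obtain ⟨f, hf⟩ := exists_equiv_orbits_prod hW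
  have hce (p) : c (e p) = c (e (p.1, 1)) := by rw [← hc p.2 (e (p.1, 1)), ← he]
  have hcf (p) : c' (f p) = c' (f (p.1, 1)) := by rw [← hc' p.2 (f (p.1, 1)), ← hf]
  have hfib (y : ι) : Nonempty ({q // c (e (q, 1)) = y} ≃ {q // c' (f (q, 1)) = y}) := by
    obtain ⟨g⟩ := h y
    have : Countable (MulAction.orbitRel.Quotient A V) := Quotient.countable
    have : Countable (MulAction.orbitRel.Quotient A W) := Quotient.countable
    refine nonempty_equiv_of_prod_equiv (A := A) ?_
    calc {q // c (e (q, 1)) = y} × A ≃ {p // c (e p) = y} :=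
          Equiv.prodSubtypeFstEquivSubtypeProd.symm.trans
            (Equiv.subtypeEquivRight fun p => by rw [hce p])
      _ ≃ {v // c v = y} := e.subtypeEquiv fun p => Iff.rfl
      _ ≃ {w // c' w = y} := g
      _ ≃ {p // c' (f p) = y} := (f.subtypeEquiv fun p => Iff.rfl).symm
      _ ≃ {q // c' (f (q, 1)) = y} × A :=
          (Equiv.subtypeEquivRight fun p => by rw [hcf p]).trans
            Equiv.prodSubtypeFstEquivSubtypeProd
  have g := fun y => (hfib y).some
  set τ : MulAction.orbitRel.Quotient A V ≃ MulAction.orbitRel.Quotient A W :=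
    (Equiv.sigmaFiberEquiv fun q => c (e (q, 1))).symm.trans
      ((Equiv.sigmaCongrRight g).trans (Equiv.sigmaFiberEquiv fun q => c' (f (q, 1))))
  have hτ (q) : c' (f (τ q, 1)) = c (e (q, 1)) := (g (c (e (q, 1))) ⟨q, rfl⟩).2
  refine ⟨e.symm.trans ((Equiv.prodCongrLeft fun _ => τ).trans f), fun a v => ?_, fun v => ?_⟩
  · obtain ⟨⟨q, b⟩, rfl⟩ := e.surjective v
    have : a • e (q, b) = e (q, a * b) := by rw [he, he q (a * b), mul_smul]
    rw [this]
    simp only [Equiv.trans_apply, Equiv.symm_apply_apply, Equiv.prodCongrLeft_apply]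
    rw [hf, hf _ b, mul_smul]
  · obtain ⟨⟨q, b⟩, rfl⟩ := e.surjective v
    simp only [Equiv.trans_apply, Equiv.symm_apply_apply, Equiv.prodCongrLeft_apply]
    rw [hcf, hce, hτ]

/-- The index `k` such that `x ∈ E (2 * k)`, if there is one. -/
noncomputable def evenPiece {V : Type*} (E : ℕ → Finset V) (x : V) : Option ℕ :=
  if h : ∃ k, x ∈ E (2 * k) then some h.choose else none

lemma evenPiece_eq_some {V : Type*} {E : ℕ → Finset V}
    (hE : Pairwise (Function.onFun Disjoint E)) {x : V} {k : ℕ} :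
    evenPiece E x = some k ↔ x ∈ E (2 * k) := by
  unfold evenPiece
  split_ifs with h
  · rw [Option.some_inj]
    refine ⟨fun hk => hk ▸ h.choose_spec, fun hk => ?_⟩
    by_contra hne
    exact Finset.disjoint_left.1 (hE (show 2 * h.choose ≠ 2 * k by omega)) h.choose_spec hk
  · simpa using fun hk => h ⟨k, hk⟩

lemma evenPiece_eq_none {V : Type*} {E : ℕ → Finset V} {x : V} :
    evenPiece E x = none ↔ ∀ k, x ∉ E (2 * k) := by
  unfold evenPiece
  split_ifs with h
  · simpa using h
  · simpa using h

lemma evenPiece_smul {A V : Type*} [Group A] [MulAction A V] {E : ℕ → Finset V}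
    (hE : Pairwise (Function.onFun Disjoint E)) (hA : ∀ n (a : A), a • E n = E n) (a : A) (x : V) :
    evenPiece E (a • x) = evenPiece E x := by
  ext k
  rw [evenPiece_eq_some hE, evenPiece_eq_some hE]
  conv_lhs => rw [← hA _ a]
  exact Finset.smul_mem_smul_finset_iff a

lemma infinite_evenPiece_eq_none {V : Type*} {E : ℕ → Finset V}
    (hE : Pairwise (Function.onFun Disjoint E)) (hne : ∀ n, (E n).Nonempty) :
    Infinite {x // evenPiece E x = none} := by
  choose x hx using hne
  refine Infinite.of_injective (fun n : ℕ => (⟨x (2 * n + 1), evenPiece_eq_none.2 fun k hk =>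
    Finset.disjoint_left.1 (hE (show 2 * n + 1 ≠ 2 * k by omega)) (hx _) hk⟩ :
      {x // evenPiece E x = none})) fun m n hmn => ?_
  by_contra hne
  refine Finset.disjoint_left.1 (hE (show 2 * m + 1 ≠ 2 * n + 1 by omega)) (hx _) ?_
  have h : x (2 * m + 1) = x (2 * n + 1) := Subtype.ext_iff.1 hmn
  exact h ▸ hx _

lemma exists_equivariant_equiv_map_eq {A V W : Type*} [Group A] [Finite A] [MulAction A V]
    [MulAction A W] [Countable V] [Countable W] (hV : ∀ (a : A) (v : V), a • v = v → a = 1)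
    (hW : ∀ (a : A) (w : W), a • w = w → a = 1) (E : ℕ → Finset V) (F : ℕ → Finset W)
    (hcard : ∀ n, #(E n) = #(F n)) (hne : ∀ n, (E n).Nonempty)
    (hE : Pairwise (Function.onFun Disjoint E)) (hF : Pairwise (Function.onFun Disjoint F))
    (hEA : ∀ n (a : A), a • E n = E n) (hFA : ∀ n (a : A), a • F n = F n) :
    ∃ σ : V ≃ W, (∀ (a : A) v, σ (a • v) = a • σ v) ∧
      ∀ n, (E (2 * n)).map σ.toEmbedding = F (2 * n) := by
  obtain ⟨σ, hσ, hσc⟩ := exists_equivariant_equiv hV hW (evenPiece E) (evenPiece F)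
    (evenPiece_smul hE hEA) (evenPiece_smul hF hFA) (by
      rintro (_ | k)
      · have := infinite_evenPiece_eq_none hE hne
        have := infinite_evenPiece_eq_none hF fun n => by
          rw [← Finset.card_pos, ← hcard]; exact (hne n).card_pos
        infer_instance
      · exact ⟨(Equiv.subtypeEquivRight fun x => evenPiece_eq_some hE).trans
          ((Finset.equivOfCardEq (hcard (2 * k))).trans
            (Equiv.subtypeEquivRight fun x => evenPiece_eq_some hF).symm)⟩)
  refine ⟨σ, hσ, fun n => ?_⟩
  ext w
  rw [← evenPiece_eq_some hF, Finset.mem_map_equiv, ← evenPiece_eq_some hE, ← hσc,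
    Equiv.apply_symm_apply]

/-- If `G` is infinite amenable and `A` acts freely on an amenable `H`-set, then `G` (as a left
`G`-set) carries an action of `H` compatible over `A` such that some mean is invariant under both
actions, and in which elements outside of `A` do not preserve all `A`-orbits. -/
lemma exists_compatible_action {G H A Y : Type*} [Group G] [Group H] [Group A] [Countable G]
    [Countable H] [Finite A] [Infinite G] [Countable Y] (hG : AmenableGroup G) (iG : A →* G)
    (iH : A →* H) (hiG : Function.Injective iG) (hiH : Function.Injective iH)
    (ψ : H →* Equiv.Perm Y) (hamen : AmenableAction ψ)
    (hfree : ∀ (a : A) (y : Y), ψ (iH a) y = y → a = 1) :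
    ∃ (θ : H →* Equiv.Perm G) (μ : Set G → ℝ), (∀ a g, θ (iH a) g = iG a * g) ∧
      IsFinitelyAdditive μ ∧ (∀ (g : G) S, μ (g • S) = μ S) ∧ (∀ h S, μ (θ h '' S) = μ S) ∧
      ∀ h ∉ iH.range, ∃ z, ∀ a, θ h z ≠ iG a * z := by
  let : MulAction H Y := MulAction.compHom Y ψ
  let W := Σ _ : ℕ, Y ⊕ H
  let : MulAction A G := MulAction.compHom G iG
  let : MulAction A W := MulAction.compHom W iH
  obtain ⟨E, F, hcard, hne, hE, hF, hEA, hFA, hEf, hFf⟩ := exists_matching_folner_sequences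
    (isRich_self hG iG) (isRich_sigma_sum (K := H) (W := Y) hamen iH H)
  have hfreeG (a : A) (g : G) (h : a • g = g) : a = 1 := by
    have h : iG a * g = g := h
    exact (map_eq_one_iff iG hiG).1 (by simpa using h)
  have hfreeW (a : A) (w : W) (h : a • w = w) : a = 1 := by
    obtain ⟨n, y | k⟩ := w
    · have h : (⟨n, Sum.inl (ψ (iH a) y)⟩ : W) = ⟨n, Sum.inl y⟩ := h
      exact hfree a y (by simpa using h)
    · have h : (⟨n, Sum.inr (iH a * k)⟩ : W) = ⟨n, Sum.inr k⟩ := h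
      exact (map_eq_one_iff iH hiH).1 (by simpa using h)
  obtain ⟨σ, hσ, hσE⟩ := exists_equivariant_equiv_map_eq hfreeG hfreeW E F hcard hne hE hF hEA hFA
  obtain ⟨μ, hμ, hμinv⟩ := exists_mean_of_folner (fun n => E (2 * n)) fun n => hne _
  have htwo : Filter.Tendsto (fun n : ℕ => 2 * n) Filter.atTop Filter.atTop :=
    StrictMono.tendsto_atTop fun m n hmn => by simpa using hmn
  let θ : H →* Equiv.Perm G := σ.symm.permCongrHom.toMonoidHom.comp (MulAction.toPermHom H W)
  have hθ (h : H) (g : G) : θ h g = σ.symm (h • σ g) := rfl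
  refine ⟨θ, μ, fun a g => ?_, hμ, fun g S => ?_, fun h S => ?_, fun h hh => ?_⟩
  · rw [hθ]
    exact σ.symm_apply_eq.2 (hσ a g).symm
  · refine hμinv (MulAction.toPerm g) (fun N => ?_) S
    filter_upwards [htwo.eventually (hEf g N)] with n hn
    rwa [Finset.map_eq_image]
  · refine hμinv (θ h) (fun N => ?_) S
    filter_upwards [htwo.eventually (hFf h N)] with n hn
    have hEF : E (2 * n) = (F (2 * n)).map σ.symm.toEmbedding := by
      rw [← hσE, Finset.map_map]
      ext; simp
    have hmap : (E (2 * n)).map (θ h).toEmbedding \ E (2 * n) =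
        (h • F (2 * n) \ F (2 * n)).map σ.symm.toEmbedding := by
      rw [hEF, Finset.map_sdiff, Finset.map_map]
      congr 1
      ext x
      simp [Finset.mem_smul_finset, hθ, Equiv.symm_apply_eq]
    rw [hmap, Finset.card_map, hcard]
    convert hn
    rfl
  · refine ⟨σ.symm ⟨0, Sum.inr 1⟩, fun a ha => hh ?_⟩
    rw [hθ, Equiv.apply_symm_apply, Equiv.symm_apply_eq] at ha
    have h1 := hσ a (σ.symm ⟨0, Sum.inr 1⟩)
    rw [Equiv.apply_symm_apply] at h1
    have h2 : (⟨0, Sum.inr (h * 1)⟩ : W) = ⟨0, Sum.inr (iH a * 1)⟩ := ha.trans h1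
    exact ⟨a, by simpa using h2.symm⟩

/-- The involution exchanging two disjoint injective families. -/
lemma exists_perm_exchange {A X : Type*} (f g : A ↪ X) (hfg : ∀ a b, f a ≠ g b) :
    ∃ τ : Equiv.Perm X, (∀ a, τ (f a) = g a) ∧ (∀ a, τ (g a) = f a) ∧
      ∀ x, (∀ a, f a ≠ x) → (∀ a, g a ≠ x) → τ x = x := by
  let ι : A ⊕ A ↪ X := ⟨Sum.elim f g, f.injective.sumElim g.injective hfg⟩
  let s : Equiv.Perm (A ⊕ A) := Equiv.sumComm A A
  refine ⟨s.viaEmbedding ι, fun a => s.viaEmbedding_apply ι (Sum.inl a),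
    fun a => s.viaEmbedding_apply ι (Sum.inr a), fun x hf hg => ?_⟩
  refine s.viaEmbedding_apply_of_notMem ι x ?_
  rintro ⟨a | a, rfl⟩
  · exact hf a rfl
  · exact hg a rfl

section Amalgam

variable {A G H P : Type} [Group A] [Group G] [Group H] [Group P] {iG : A →* G} {iH : A →* H}
  {jG : G →* P} {jH : H →* P}

lemma closure_range_union_range_eq_top (hP : IsAmalgamatedProduct iG iH jG jH) :
    Subgroup.closure (Set.range jG ∪ Set.range jH) = ⊤ := by
  set N := Subgroup.closure (Set.range jG ∪ Set.range jH)
  have hGN (g : G) : jG g ∈ N := Subgroup.subset_closure (Or.inl ⟨g, rfl⟩)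
  have hHN (h : H) : jH h ∈ N := Subgroup.subset_closure (Or.inr ⟨h, rfl⟩)
  obtain ⟨r, ⟨hrG, hrH⟩, -⟩ := hP.2 N (jG.codRestrict N hGN) (jH.codRestrict N hHN) (by
    ext a; exact DFunLike.congr_fun hP.1 a)
  have hr := (hP.2 P jG jH hP.1).unique (y₁ := N.subtype.comp r) (y₂ := MonoidHom.id P)
    ⟨by rw [MonoidHom.comp_assoc, hrG]; rfl, by rw [MonoidHom.comp_assoc, hrH]; rfl⟩ ⟨rfl, rfl⟩
  refine eq_top_iff.2 fun p _ => ?_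
  rw [show p = r p from (DFunLike.congr_fun hr p).symm]
  exact (r p).2

lemma amalgam_induction (hP : IsAmalgamatedProduct iG iH jG jH) {C : P → Prop} (one : C 1)
    (mul_left_G : ∀ g p, C p → C (jG g * p)) (mul_left_H : ∀ h p, C p → C (jH h * p)) (p : P) :
    C p := by
  have hp : p ∈ Subgroup.closure (Set.range jG ∪ Set.range jH) := by
    rw [closure_range_union_range_eq_top hP]; trivial
  induction hp using Subgroup.closure_induction_left with
  | one => exact one
  | mul_left x hx y _ ih =>
    rcases hx with ⟨g, rfl⟩ | ⟨h, rfl⟩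
    · exact mul_left_G g y ih
    · exact mul_left_H h y ih
  | inv_mul_cancel x hx y _ ih =>
    rcases hx with ⟨g, rfl⟩ | ⟨h, rfl⟩
    · rw [← map_inv]; exact mul_left_G _ y ih
    · rw [← map_inv]; exact mul_left_H _ y ih

lemma countable_amalgam [Countable G] [Countable H] (hP : IsAmalgamatedProduct iG iH jG jH) :
    Countable P := by
  have h : Function.Surjective (FreeMonoid.lift (Sum.elim jG jH)) := fun p => by
    refine amalgam_induction (C := fun p => ∃ w, FreeMonoid.lift (Sum.elim jG jH) w = p) hP
      ⟨1, map_one _⟩ ?_ ?_ p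
    · rintro g _ ⟨w, rfl⟩
      exact ⟨FreeMonoid.of (Sum.inl g) * w, by simp⟩
    · rintro h _ ⟨w, rfl⟩
      exact ⟨FreeMonoid.of (Sum.inr h) * w, by simp⟩
  have : Countable (FreeMonoid (G ⊕ H)) := inferInstanceAs (Countable (List (G ⊕ H)))
  exact h.countable

lemma exists_amalgam_lift (hP : IsAmalgamatedProduct iG iH jG jH) {L : Type} [Group L]
    (fG : G →* L) (fH : H →* L) (h : ∀ a, fG (iG a) = fH (iH a)) :
    ∃ f : P →* L, (∀ g, f (jG g) = fG g) ∧ ∀ k, f (jH k) = fH k := by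
  obtain ⟨f, ⟨h1, h2⟩, -⟩ := hP.2 L fG fH (MonoidHom.ext h)
  exact ⟨f, DFunLike.congr_fun h1, DFunLike.congr_fun h2⟩

lemma inClassA_of_surjective [Countable G] (hP : IsAmalgamatedProduct iG iH jG jH)
    (hiH : ∀ h, h ∈ iH.range) (ρ : P →* Equiv.Perm G) (hρ : ∀ g z, ρ (jG g) z = g * z)
    {μ : Set G → ℝ} (hμ : IsFinitelyAdditive μ) (hinv : ∀ (g : G) S, μ (g • S) = μ S) :
    InClassA P := by
  have hsurj (p : P) : ∃ g, jG g = p := by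
    refine amalgam_induction (C := fun p => ∃ g, jG g = p) hP ⟨1, map_one _⟩ ?_ ?_ p
    · rintro g _ ⟨g', rfl⟩
      exact ⟨g * g', map_mul _ _ _⟩
    · rintro h _ ⟨g', rfl⟩
      obtain ⟨a, rfl⟩ := hiH h
      exact ⟨iG a * g', by rw [map_mul, show jG (iG a) = jH (iH a) from DFunLike.congr_fun hP.1 a]⟩
  refine ⟨G, inferInstance, ρ, (injective_iff_map_eq_one ρ).2 fun p hp => ?_, fun x y =>
    ⟨jG (y * x⁻¹), by rw [hρ, inv_mul_cancel_right]⟩, μ, hμ.nonneg, hμ.univ, hμ.union,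
    fun p S => ?_⟩
  · obtain ⟨g, rfl⟩ := hsurj p
    have h := hρ g 1
    rw [hp, mul_one] at h
    rw [← h]
    exact map_one _
  · obtain ⟨g, rfl⟩ := hsurj p
    rw [show ⇑(ρ (jG g)) = fun x => g • x from funext (hρ g)]
    exact hinv g S

lemma finite_disagreement (hP : IsAmalgamatedProduct iG iH jG jH) {X : Type*}
    (ρ σ : P →* Equiv.Perm X) (hG : ∀ g, {x | ρ (jG g) x ≠ σ (jG g) x}.Finite)
    (hH : ∀ h, {x | ρ (jH h) x ≠ σ (jH h) x}.Finite) (p : P) : {x | ρ p x ≠ σ p x}.Finite := by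
  have hmul (p q : P) (hp : {x | ρ p x ≠ σ p x}.Finite) (hq : {x | ρ q x ≠ σ q x}.Finite) :
      {x | ρ (p * q) x ≠ σ (p * q) x}.Finite := by
    refine (hq.union (hp.preimage (f := σ q) (σ q).injective.injOn)).subset fun x hx => ?_
    by_contra! hcon
    simp only [Set.mem_union, Set.mem_ofPred_eq, Set.mem_preimage, not_or, not_not] at hcon
    refine hx ?_
    rw [map_mul, map_mul, Equiv.Perm.mul_apply, Equiv.Perm.mul_apply, hcon.1, hcon.2]
  exact amalgam_induction (C := fun p => {x | ρ p x ≠ σ p x}.Finite) hP (by simp)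
    (fun g p => hmul _ _ (hG g)) (fun h p => hmul _ _ (hH h)) p

lemma IsFinitelyAdditive.finite_eq_zero {X : Type*} {μ : Set X → ℝ} (hμ : IsFinitelyAdditive μ)
    (h0 : ∀ x, μ {x} = 0) {S : Set X} (hS : S.Finite) : μ S = 0 := by
  induction S, hS using Set.Finite.induction_on with
  | empty => exact hμ.empty
  | @insert a s ha _ ih =>
    rw [Set.insert_eq, hμ.union _ _ (by simpa using ha), ih, h0, add_zero]

lemma IsFinitelyAdditive.singleton_eq_zero [Infinite G] {μ : Set G → ℝ}
    (hμ : IsFinitelyAdditive μ) (hinv : ∀ (g : G) S, μ (g • S) = μ S) (x : G) : μ {x} = 0 := by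
  have hx (y : G) : μ {y} = μ {x} := by
    rw [← hinv (y * x⁻¹) {x}]; simp
  refine le_antisymm (le_of_forall_pos_le_add fun ε hε => ?_) (hμ.nonneg _)
  obtain ⟨n, hn⟩ := exists_nat_gt (1 / ε)
  obtain ⟨s, rfl⟩ := Infinite.exists_subset_card_eq G n
  have h1 := hμ.biUnion s (fun y => {y}) fun a _ b _ hab => by simpa using hab
  have h2 := hμ.mono (Set.subset_univ (⋃ i ∈ s, {i}))
  rw [h1, hμ.univ, Finset.sum_congr rfl fun y _ => hx y, Finset.sum_const, nsmul_eq_mul] at h2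
  rw [div_lt_iff₀ hε] at hn
  have hs : (0 : ℝ) < s.card := by
    by_contra! h
    nlinarith
  rw [zero_add]
  exact le_of_mul_le_mul_left (h2.trans hn.le) hs

lemma IsFinitelyAdditive.image_perm_eq {X : Type*} {μ : Set X → ℝ} (hμ : IsFinitelyAdditive μ)
    (h0 : ∀ x, μ {x} = 0) (τ : Equiv.Perm X) (hτ : {x | τ x ≠ x}.Finite) (S : Set X) :
    μ (τ '' S) = μ S := by
  refine hμ.eq_of_null_diff (hμ.finite_eq_zero h0 ((hτ.image τ).subset ?_))
    (hμ.finite_eq_zero h0 (hτ.subset ?_))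
  · rintro _ ⟨⟨x, hx, rfl⟩, hx'⟩
    exact ⟨x, fun h => hx' (by rwa [h]), rfl⟩
  · rintro x ⟨hx, hx'⟩ h
    exact hx' ⟨x, hx, h⟩

lemma inClassA_of_exchange [Countable G] [Countable H] [Finite A] [Infinite G]
    (hP : IsAmalgamatedProduct iG iH jG jH) (hiG : Function.Injective iG)
    (ρZ : P →* Equiv.Perm G) (hρZ : ∀ g z, ρZ (jG g) z = g * z)
    {μ : Set G → ℝ} (hμ : IsFinitelyAdditive μ) (hG : ∀ (g : G) S, μ (g • S) = μ S)
    (hH : ∀ h S, μ (ρZ (jH h) '' S) = μ S) (h₀ : H) (z₀ : G)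
    (hz₀ : ∀ a, ρZ (jH h₀) z₀ ≠ iG a * z₀) : InClassA P := by
  have hcomm (a : A) : jG (iG a) = jH (iH a) := DFunLike.congr_fun hP.1 a
  have hjG : Function.Injective jG := fun g g' h => by
    have h1 := hρZ g 1
    rw [h, hρZ] at h1
    simpa using h1.symm
  have : Infinite P := Infinite.of_injective jG hjG
  have := countable_amalgam hP
  let σ : P →* Equiv.Perm (P ⊕ G) :=
    (Equiv.Perm.sumCongrHom P G).comp ((MulAction.toPermHom P P).prod ρZ)
  have hσl (p q : P) : σ p (Sum.inl q) = Sum.inl (p * q) := rfl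
  have hσr (p : P) (z : G) : σ p (Sum.inr z) = Sum.inr (ρZ p z) := rfl
  let f : A ↪ P ⊕ G := ⟨fun a => Sum.inl (jG (iG a)), fun a b h =>
    hiG (hjG (Sum.inl_injective h))⟩
  let f' : A ↪ P ⊕ G := ⟨fun a => Sum.inr (iG a * z₀), fun a b h =>
    hiG (mul_right_cancel (Sum.inr_injective h))⟩
  obtain ⟨τ, hτf, hτf', hτ⟩ := exists_perm_exchange f f' fun a b => Sum.inl_ne_inr
  have hσf (a b : A) : σ (jG (iG a)) (f b) = f (a * b) := by
    change σ _ (Sum.inl _) = Sum.inl _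
    rw [hσl, map_mul, map_mul]
  have hσf' (a b : A) : σ (jG (iG a)) (f' b) = f' (a * b) := by
    change σ _ (Sum.inr _) = Sum.inr _
    rw [hσr, hρZ, map_mul, mul_assoc]
  have hcases (x : P ⊕ G) : (∃ a, f a = x) ∨ (∃ a, f' a = x) ∨
      (∀ a, f a ≠ x) ∧ ∀ a, f' a ≠ x := by
    by_cases h1 : ∃ a, f a = x
    · exact Or.inl h1
    by_cases h2 : ∃ a, f' a = x
    · exact Or.inr (Or.inl h2)
    push Not at h1 h2
    exact Or.inr (Or.inr ⟨h1, h2⟩)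
  have hττ (x : P ⊕ G) : τ (τ x) = x := by
    obtain ⟨a, rfl⟩ | ⟨a, rfl⟩ | ⟨h1, h2⟩ := hcases x
    · rw [hτf, hτf']
    · rw [hτf', hτf]
    · rw [hτ x h1 h2, hτ x h1 h2]
  have hτinv : τ⁻¹ = τ := inv_eq_of_mul_eq_one_left (Equiv.ext hττ)
  have hτσ (a : A) (x : P ⊕ G) : τ (σ (jG (iG a)) x) = σ (jG (iG a)) (τ x) := by
    obtain ⟨b, rfl⟩ | ⟨b, rfl⟩ | ⟨h1, h2⟩ := hcases x
    · rw [hσf, hτf, hτf, hσf']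
    · rw [hσf', hτf', hτf', hσf]
    · rw [hτ x h1 h2]
      refine hτ _ (fun b hb => h1 (a⁻¹ * b) ?_) fun b hb => h2 (a⁻¹ * b) ?_
      · rw [← hσf, hb, ← Equiv.Perm.mul_apply, ← map_mul, ← map_mul, ← map_mul, inv_mul_cancel]
        simp
      · rw [← hσf', hb, ← Equiv.Perm.mul_apply, ← map_mul, ← map_mul, ← map_mul, inv_mul_cancel]
        simp
  have hsupp : {x | τ x ≠ x}.Finite := by
    refine ((Set.finite_range f).union (Set.finite_range f')).subset fun x hx => ?_
    obtain h | h | ⟨h1, h2⟩ := hcases x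
    · exact Or.inl h
    · exact Or.inr h
    · exact absurd (hτ x h1 h2) hx
  obtain ⟨ρ, hρG, hρH'⟩ := exists_amalgam_lift hP (σ.comp jG)
    ((MulAut.conj τ).toMonoidHom.comp (σ.comp jH)) fun a => by
      ext1 x
      change σ (jG (iG a)) x = τ (σ (jH (iH a)) (τ⁻¹ x))
      rw [← hcomm, hτσ, hτinv, hττ]
  have hρG (g : G) : ρ (jG g) = σ (jG g) := hρG g
  have hρH (h : H) (x : P ⊕ G) : ρ (jH h) x = τ (σ (jH h) (τ x)) := by
    rw [hρH']
    change τ (σ (jH h) (τ⁻¹ x)) = _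
    rw [hτinv]
  have hτinl (p : P) (hp : ∀ a, jG (iG a) ≠ p) : τ (Sum.inl p) = Sum.inl p :=
    hτ _ (fun a h => hp a (Sum.inl_injective h)) fun a h => Sum.inr_ne_inl h
  have hτinr (z : G) (hz : ∀ a, z ≠ iG a * z₀) : τ (Sum.inr z) = Sum.inr z :=
    hτ _ (fun a h => Sum.inl_ne_inr h) fun a h => hz a (Sum.inr_injective h).symm
  have hτone : τ (Sum.inl 1) = Sum.inr z₀ := by
    have h : τ (Sum.inl (jG (iG 1))) = Sum.inr (iG 1 * z₀) := hτf 1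
    simpa using h
  have hτz₀ : τ (Sum.inr z₀) = Sum.inl 1 := by rw [← hτone, hττ]
  let R : Set (P ⊕ G) := {x | ∃ p, ρ p (Sum.inr z₀) = x}
  have hR {x : P ⊕ G} (p : P) (hx : x ∈ R) : ρ p x ∈ R := by
    obtain ⟨q, rfl⟩ := hx
    exact ⟨p * q, by rw [map_mul, Equiv.Perm.mul_apply]⟩
  have hR' {x : P ⊕ G} (p : P) (hx : ρ p x ∈ R) : x ∈ R := by
    simpa using hR p⁻¹ hx
  have hRz₀ : Sum.inr z₀ ∈ R := ⟨1, by simp⟩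
  have hRr (z : G) : Sum.inr z ∈ R :=
    ⟨jG (z * z₀⁻¹), by rw [hρG, hσr, hρZ, inv_mul_cancel_right]⟩
  have hRone : Sum.inl 1 ∈ R := by
    refine hR' (jH h₀) ?_
    rw [hρH, hτone, hσr, hτinr _ hz₀]
    exact hRr _
  have hRG (g : G) (p : P) (hp : Sum.inl p ∈ R) : Sum.inl (jG g * p) ∈ R := by
    rw [← hσl, ← hρG]
    exact hR _ hp
  have hRA (a : A) : Sum.inl (jG (iG a)) ∈ R := by simpa using hRG (iG a) 1 hRone
  have hRH (h : H) : Sum.inl (jH h) ∈ R := by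
    by_cases hh : ∃ a, jG (iG a) = jH h
    · obtain ⟨a, ha⟩ := hh
      exact ha ▸ hRA a
    · push Not at hh
      have := hR (jH h) hRz₀
      rwa [hρH, hτz₀, hσl, mul_one, hτinl _ hh] at this
  have hRl (p : P) : Sum.inl p ∈ R := by
    refine amalgam_induction (C := fun p => Sum.inl p ∈ R) hP hRone hRG (fun h p hp => ?_) p
    by_cases h1 : ∃ a, jG (iG a) = p
    · obtain ⟨a, rfl⟩ := h1
      rw [hcomm, ← map_mul]
      exact hRH _
    by_cases h2 : ∃ a, jG (iG a) = jH h * p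
    · obtain ⟨a, ha⟩ := h2
      exact ha ▸ hRA a
    push Not at h1 h2
    have := hR (jH h) hp
    rwa [hρH, hτinl _ h1, hσl, hτinl _ h2] at this
  have hRx (x : P ⊕ G) : x ∈ R := by
    obtain p | z := x
    · exact hRl p
    · exact hRr z
  have hfin := finite_disagreement hP ρ σ (fun g => by simp [hρG]) fun h => by
    refine (hsupp.union (hsupp.preimage (f := σ (jH h)) (σ _).injective.injOn)).subset
      fun x hx => ?_
    by_contra! hcon
    simp only [Set.mem_union, Set.mem_ofPred_eq, Set.mem_preimage, not_or, not_not] at hcon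
    exact hx (by rw [hρH, hcon.1, hcon.2])
  let ν : Set (P ⊕ G) → ℝ := fun B => μ (Sum.inr ⁻¹' B)
  have hν : IsFinitelyAdditive ν :=
    ⟨fun B => hμ.nonneg _, hμ.univ, fun B C hBC => hμ.union _ _ (hBC.preimage _)⟩
  have hν0 (x : P ⊕ G) : ν {x} = 0 := by
    refine hμ.finite_eq_zero (hμ.singleton_eq_zero hG) ?_
    exact (Set.finite_singleton x).preimage Sum.inr_injective.injOn
  have hντ := hν.image_perm_eq hν0 τ hsupp
  have hpre (p : P) (B : Set (P ⊕ G)) :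
      Sum.inr ⁻¹' (σ p '' B) = ρZ p '' (Sum.inr ⁻¹' B) := by
    ext z
    constructor
    · rintro ⟨q | w, hx, hxz⟩
      · exact absurd hxz Sum.inl_ne_inr
      · exact ⟨w, hx, Sum.inr_injective hxz⟩
    · rintro ⟨w, hw, rfl⟩
      exact ⟨_, hw, rfl⟩
  have hνG (g : G) (B : Set (P ⊕ G)) : ν (ρ (jG g) '' B) = ν B := by
    rw [hρG]
    change μ _ = μ _
    rw [hpre, show ⇑(ρZ (jG g)) = fun x => g • x from funext (hρZ g)]
    exact hG g _
  have hνH (h : H) (B : Set (P ⊕ G)) : ν (ρ (jH h) '' B) = ν B := by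
    have : ρ (jH h) '' B = τ '' (σ (jH h) '' (τ '' B)) := by
      simp only [Set.image_image, hρH]
    rw [this, hντ, ← hντ B]
    change μ _ = μ _
    rw [hpre, hH]
  refine ⟨P ⊕ G, inferInstance, ρ, (injective_iff_map_eq_one ρ).2 fun p hp => ?_, fun x y => ?_,
    ν, hν.nonneg, hν.univ, hν.union, fun p => ?_⟩
  · obtain ⟨q, hq⟩ := ((hfin p).preimage (f := Sum.inl) Sum.inl_injective.injOn).exists_notMem
    have h1 : ρ p (Sum.inl q) = σ p (Sum.inl q) := by simpa using hq
    rw [hp, hσl] at h1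
    simpa using (Sum.inl_injective h1).symm
  · obtain ⟨p, rfl⟩ := hRx x
    obtain ⟨q, rfl⟩ := hRx y
    exact ⟨q * p⁻¹, by simp⟩
  · refine amalgam_induction (C := fun p => ∀ B, ν (ρ p '' B) = ν B) hP (by simp)
      (fun g p ih B => ?_) (fun h p ih B => ?_) p
    · rw [map_mul, Equiv.Perm.coe_mul, Set.image_comp, hνG, ih]
    · rw [map_mul, Equiv.Perm.coe_mul, Set.image_comp, hνH, ih]

end Amalgam

end AmalgamClassA

/-- Theorem 2 (Moon, arXiv:1003.3998).
Let `G` and `H` be countable groups and `A` a common finite subgroup of `G` and `H`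
(given by injective homomorphisms `iG : A → G` and `iH : A → H`). If `G` is an infinite
amenable group and there is a countable `H`-set `Y` such that the `H`-action is amenable
and the restricted action of `A` on `Y` is free, then `G ∗_A H` is in the class `𝒜`. -/
theorem amalgam_infinite_amenable_finite_subgroup_mem_classA
    (G H A : Type) [Group G] [Group H] [Group A]
    [Countable G] [Countable H] [Finite A] [Infinite G]
    (hG : AmenableGroup G)
    (iG : A →* G) (iH : A →* H)
    (hiG : Function.Injective iG) (hiH : Function.Injective iH)
    (Y : Type) [Countable Y] (ψ : H →* Equiv.Perm Y)
    (hamen : AmenableAction ψ)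
    (hfree : ∀ (a : A) (y : Y), ψ (iH a) y = y → a = 1)
    (P : Type) [Group P] (jG : G →* P) (jH : H →* P)
    (hP : IsAmalgamatedProduct iG iH jG jH) :
    InClassA P := by
  obtain ⟨θ, μ, hθA, hμ, hμG, hμH, hθ⟩ :=
    AmalgamClassA.exists_compatible_action hG iG iH hiG hiH ψ hamen hfree
  obtain ⟨ρ, hρG, hρH⟩ := AmalgamClassA.exists_amalgam_lift hP (MulAction.toPermHom G G) θ
    fun a => Equiv.ext fun g => (hθA a g).symm
  have hρ (g z : G) : ρ (jG g) z = g * z := by rw [hρG]; rfl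
  by_cases h : ∀ h, h ∈ iH.range
  · exact AmalgamClassA.inClassA_of_surjective hP h ρ hρ hμ hμG
  · push Not at h
    obtain ⟨h₀, hh₀⟩ := h
    obtain ⟨z₀, hz₀⟩ := hθ h₀ hh₀
    exact AmalgamClassA.inClassA_of_exchange hP hiG ρ hρ hμ hμG (fun h S => by rw [hρH, hμH]) h₀ z₀
      fun a => by rw [hρH]; exact hz₀ a
end

section
/- Let G and H be countable groups and let A be a common finite subgroup of G and H. Suppose G is an infinite amenable group and there exists a countable set Y with an H-action that is amenable and on which the restricted action of A is free. Then there exist a countable G-set X' and a countable H-set Y' such that: (i) the G-action on X' is transitive; (ii) for every g ∈ G∖A the set {x ∈ X' : A·x ∩ gA·x = ∅} is infinite, and for every h ∈ H∖A the set {y ∈ Y' : A·y ∩ hA·y = ∅} is infinite; (iii) there exist Følner sequences {C_n} for the G-action on X' and {D_n} for the H-action on Y' with |C_n| = |D_n| for all n ≥ 1, the sets {A·C_n}_{n≥1} pairwise disjoint, and the sets {A·D_n}_{n≥1} pairwise disjoint; and (iv) the restricted actions of A on X' and on Y' are free. -/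
/-- A Følner sequence for the action of `G` on `X` given by `φ`: a sequence of finite
non-empty subsets `C n` of `X` with `|C n △ g • C n| / |C n| → 0` for every `g : G`. -/
def IsFolnerSeq {G X : Type*} [Group G] (φ : G →* Equiv.Perm X) (C : ℕ → Set X) : Prop :=
  (∀ n, (C n).Finite ∧ (C n).Nonempty) ∧
  ∀ g : G, Filter.Tendsto
    (fun n => ((symmDiff (C n) ((φ g) '' C n)).ncard : ℝ) / ((C n).ncard : ℝ))
    Filter.atTop (nhds 0)

namespace IsInvariantMean

variable {G X : Type*} [Group G] {φ : G →* Equiv.Perm X} {μ : Set X → ℝ}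

theorem apply_empty (hμ : IsInvariantMean φ μ) : μ ∅ = 0 := by
  simpa using hμ.2.2.1 ∅ ∅ (Set.disjoint_empty _)

theorem apply_le_one (hμ : IsInvariantMean φ μ) (S : Set X) : μ S ≤ 1 := by
  have h := hμ.2.2.1 S Sᶜ disjoint_compl_right
  rw [Set.union_compl_self, hμ.2.1] at h
  linarith [hμ.1 Sᶜ]

theorem apply_biUnion (hμ : IsInvariantMean φ μ) {ι : Type*} (s : Finset ι) {B : ι → Set X}
    (hB : (s : Set ι).PairwiseDisjoint B) : μ (⋃ i ∈ s, B i) = ∑ i ∈ s, μ (B i) := by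
  classical
  induction s using Finset.induction_on with
  | empty => simp [hμ.apply_empty]
  | insert i s hi ih =>
    rw [Finset.coe_insert, Set.pairwiseDisjoint_insert_of_notMem (by simpa using hi)] at hB
    rw [Finset.set_biUnion_insert, Finset.sum_insert hi, ← ih hB.1]
    exact hμ.2.2.1 _ _ (Set.disjoint_iUnion₂_right.2 fun j hj => hB.2 j hj)

end IsInvariantMean

open scoped Pointwise Classical in
/-- A finite subset of an amenable action cannot double the size of all finite sets. -/
theorem exists_card_smul_lt_of_invariantMean {G X : Type*} [Group G] [MulAction G X]
    {μ : Set X → ℝ} (hμ : IsInvariantMean (MulAction.toPermHom G X) μ) (T : Finset G) :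
    ∃ F : Finset X, (T • F).card < 2 * F.card := by
  obtain ⟨-, huniv, -, hinv⟩ := id hμ
  by_contra! hT
  have hall : ∀ s : Finset (X × Bool), s.card ≤ (s.biUnion fun p => T • {p.1}).card := by
    intro s
    have hs : s ⊆ s.image Prod.fst ×ˢ (Finset.univ : Finset Bool) := fun p hp => by
      exact Finset.mem_product.2 ⟨Finset.mem_image_of_mem _ hp, Finset.mem_univ _⟩
    calc s.card ≤ 2 * (s.image Prod.fst).card := by
          simpa [mul_comm] using Finset.card_le_card hs
      _ ≤ (T • s.image Prod.fst).card := hT _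
      _ ≤ _ := Finset.card_le_card fun y hy => by
          obtain ⟨t, ht, x, hx, rfl⟩ := Finset.mem_smul.1 hy
          obtain ⟨p, hp, rfl⟩ := Finset.mem_image.1 hx
          exact Finset.mem_biUnion.2
            ⟨p, hp, Finset.smul_mem_smul ht (Finset.mem_singleton_self _)⟩
  obtain ⟨f, hf, hfT⟩ := (Finset.all_card_le_biUnion_card_iff_exists_injective _).1 hall
  have hτ : ∀ p : X × Bool, ∃ t ∈ T, t • p.1 = f p := fun p => by
    obtain ⟨t, ht, x, hx, h⟩ := Finset.mem_smul.1 (hfT p)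
    exact ⟨t, ht, by rwa [Finset.mem_singleton.1 hx] at h⟩
  choose τ hτT hτf using hτ
  let B : G × Bool → Set X := fun q => {x | τ (x, q.2) = q.1}
  have hB : ∀ b : Bool, ∑ t ∈ T, μ (B (t, b)) = 1 := by
    intro b
    rw [← hμ.apply_biUnion, ← huniv]
    · congr 1
      ext x
      simpa [B] using hτT (x, b)
    · intro t _ t' _ htt'
      exact Set.disjoint_left.2 fun x hx hx' => htt' (hx.symm.trans hx')
  have hle : ∑ q ∈ T ×ˢ (Finset.univ : Finset Bool),
      μ (MulAction.toPermHom G X q.1 '' B q) ≤ 1 := by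
    rw [← hμ.apply_biUnion]
    · exact hμ.apply_le_one _
    · intro q _ q' _ hqq'
      refine Set.disjoint_left.2 ?_
      rintro _ ⟨x, hx, rfl⟩ ⟨x', hx', h⟩
      have hx : τ (x, q.2) = q.1 := hx
      have hx' : τ (x', q'.2) = q'.1 := hx'
      have h : q'.1 • x' = q.1 • x := h
      have hfx := hτf (x, q.2)
      have hfx' := hτf (x', q'.2)
      rw [hx] at hfx
      rw [hx'] at hfx'
      have hxx := hf (hfx.symm.trans (h.symm.trans hfx'))
      refine hqq' (Prod.ext ?_ (Prod.ext_iff.1 hxx).2)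
      rw [← hx, ← hx', hxx]
  simp only [hinv, Finset.sum_product_right, hB] at hle
  norm_num at hle

open scoped Pointwise Classical in
theorem exists_finset_card_sdiff_lt_of_invariantMean {G X : Type*} [Group G] [MulAction G X]
    {μ : Set X → ℝ} (hμ : IsInvariantMean (MulAction.toPermHom G X) μ) (S : Finset G)
    {ε : ℝ} (hε : 0 < ε) :
    ∃ F : Finset X, F.Nonempty ∧ ∀ g ∈ S, ((g • F \ F).card : ℝ) < ε * F.card := by
  by_contra! hS
  have hstep : ∀ F : Finset X, (1 + ε) * F.card ≤ ((insert 1 S • F).card : ℝ) := by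
    intro F
    rcases F.eq_empty_or_nonempty with rfl | hF
    · simp
    obtain ⟨g, hg, hgF⟩ := hS F hF
    have hsub : g • F ∪ F ⊆ insert 1 S • F := Finset.union_subset
      (Finset.smul_finset_subset_smul (Finset.mem_insert_of_mem hg))
      (by simpa using Finset.smul_finset_subset_smul (t := F) (Finset.mem_insert_self 1 S))
    have hcard := Finset.card_le_card hsub
    rw [← Finset.card_sdiff_add_card] at hcard
    have : (((g • F \ F).card + F.card : ℕ) : ℝ) ≤ ((insert 1 S • F).card : ℝ) :=
      mod_cast hcard
    push_cast at this
    linarith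
  have hpow : ∀ (n : ℕ) (F : Finset X),
      (1 + ε) ^ n * F.card ≤ (((insert 1 S) ^ n • F).card : ℝ) := by
    intro n F
    induction n with
    | zero => simp
    | succ n ih =>
      calc (1 + ε) ^ (n + 1) * F.card = (1 + ε) * ((1 + ε) ^ n * F.card) := by ring
        _ ≤ (1 + ε) * ((insert 1 S ^ n • F).card : ℝ) := by gcongr
        _ ≤ _ := by rw [pow_succ', mul_smul]; exact hstep _
  obtain ⟨n, hn⟩ := pow_unbounded_of_one_lt (2 : ℝ) (by linarith : 1 < 1 + ε)
  obtain ⟨F, hF⟩ := exists_card_smul_lt_of_invariantMean hμ (insert 1 S ^ n)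
  have hF' : ((insert 1 S ^ n • F).card : ℝ) < 2 * F.card := mod_cast hF
  have := hpow n F
  have : 2 * (F.card : ℝ) ≤ (1 + ε) ^ n * F.card := by gcongr
  linarith

theorem Set.ncard_symmDiff_image_perm {X : Type*} (σ : Equiv.Perm X) {F : Set X} (hF : F.Finite) :
    (symmDiff F (σ '' F)).ncard = 2 * (σ '' F \ F).ncard := by
  have hσ : (σ '' F).Finite := hF.image σ
  have h : (F \ σ '' F).ncard = (σ '' F \ F).ncard :=
    (Set.ncard_eq_ncard_iff_ncard_sdiff_eq_ncard_sdiff hF hσ).1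
      (Set.ncard_image_of_injective F σ.injective).symm
  rw [Set.symmDiff_def, Set.ncard_union_eq
    (Set.disjoint_left.2 fun x hx hx' => hx'.2 hx.1) hF.sdiff hσ.sdiff, h, two_mul]

open scoped Pointwise Classical in
/-- An amenable action of a countable group admits a Følner sequence. -/
theorem AmenableAction.exists_isFolnerSeq {G X : Type*} [Group G] [Countable G]
    {φ : G →* Equiv.Perm X} (hφ : AmenableAction φ) : ∃ C : ℕ → Set X, IsFolnerSeq φ C := by
  obtain ⟨μ, hμ⟩ := hφ
  obtain ⟨e, he⟩ := exists_surjective_nat G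
  let _ : MulAction G X := MulAction.compHom X φ
  have hex : ∀ n : ℕ, ∃ C : Set X, (C.Finite ∧ C.Nonempty) ∧ ∀ k ≤ n,
      ((symmDiff C (φ (e k) '' C)).ncard : ℝ) / C.ncard ≤ 2 * (1 / ((n : ℝ) + 1)) := by
    intro n
    obtain ⟨F, hF, hSF⟩ := exists_finset_card_sdiff_lt_of_invariantMean (G := G) (X := X) hμ
      ((Finset.range (n + 1)).image e) (ε := 1 / ((n : ℝ) + 1)) (by positivity)
    refine ⟨F, ⟨F.finite_toSet, hF⟩, fun k hk => ?_⟩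
    have hk' := hSF (e k) (Finset.mem_image_of_mem e (Finset.mem_range.2 (by omega)))
    have hcoe : ((φ (e k) '' (F : Set X)) \ F).ncard = (e k • F \ F).card := by
      rw [← Set.ncard_coe_finset]
      rw [Finset.coe_sdiff, Finset.coe_smul_finset]
      rfl
    have hpos : (0 : ℝ) < F.card := by exact_mod_cast hF.card_pos
    rw [Set.ncard_symmDiff_image_perm _ F.finite_toSet, hcoe, Set.ncard_coe_finset,
      div_le_iff₀ hpos]
    push_cast
    linarith
  choose C hC hCe using hex
  refine ⟨C, hC, fun g => ?_⟩
  obtain ⟨k, rfl⟩ := he g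
  have hlim : Filter.Tendsto (fun n : ℕ => 2 * (1 / ((n : ℝ) + 1))) Filter.atTop (nhds 0) := by
    simpa using (tendsto_one_div_add_atTop_nhds_zero_nat (𝕜 := ℝ)).const_mul 2
  refine tendsto_of_tendsto_of_tendsto_of_le_of_le' tendsto_const_nhds hlim
    (.of_forall fun n => by positivity) ?_
  filter_upwards [Filter.eventually_ge_atTop k] with n hn using hCe n k hn

/-- The disjoint union of `m n` equivariant copies of the `n`-th set of a Følner sequence is
again a Følner sequence. -/
theorem IsFolnerSeq.iUnion_image {G X X' : Type*} [Group G] {φ : G →* Equiv.Perm X}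
    {φ' : G →* Equiv.Perm X'} {E : ℕ → Set X} (hE : IsFolnerSeq φ E) {m : ℕ → ℕ}
    (hm : ∀ n, m n ≠ 0) {j : ℕ → ℕ → X → X'} (hj : ∀ n k, Function.Injective (j n k))
    (hφ : ∀ n k g x, j n k (φ g x) = φ' g (j n k x))
    (hd : ∀ n, Pairwise fun k l => Disjoint (j n k '' E n) (j n l '' E n)) :
    IsFolnerSeq φ' (fun n => ⋃ k : Fin (m n), j n k '' E n) ∧
      ∀ n, (⋃ k : Fin (m n), j n k '' E n).ncard = m n * (E n).ncard := by
  have hcard : ∀ n, (⋃ k : Fin (m n), j n k '' E n).ncard = m n * (E n).ncard := by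
    intro n
    rw [Set.ncard_iUnion_of_finite (fun k => (hE.1 n).1.image _)
      fun k l hkl => hd n (Fin.val_injective.ne hkl)]
    simp [Set.ncard_image_of_injective _ (hj n _), finsum_eq_sum_of_fintype]
  refine ⟨⟨fun n => ⟨Set.finite_iUnion fun k => (hE.1 n).1.image _, ?_⟩, fun g => ?_⟩, hcard⟩
  · obtain ⟨x, hx⟩ := (hE.1 n).2
    exact ⟨_, Set.mem_iUnion.2 ⟨⟨0, Nat.pos_of_ne_zero (hm n)⟩, x, hx, rfl⟩⟩
  refine tendsto_of_tendsto_of_tendsto_of_le_of_le tendsto_const_nhds (hE.2 g)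
    (fun n => by positivity) fun n => ?_
  have hfin : (symmDiff (E n) (φ g '' E n)).Finite :=
    (hE.1 n).1.symmDiff ((hE.1 n).1.image _)
  have hle : (symmDiff (⋃ k : Fin (m n), j n k '' E n)
      (φ' g '' ⋃ k : Fin (m n), j n k '' E n)).ncard ≤
      m n * (symmDiff (E n) (φ g '' E n)).ncard := by
    have himg : ∀ k, φ' g '' (j n k '' E n) = j n k '' (φ g '' E n) := fun k => by
      simp only [Set.image_image, hφ]
    have hsub : symmDiff (⋃ k : Fin (m n), j n k '' E n)
        (φ' g '' ⋃ k : Fin (m n), j n k '' E n) ⊆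
        ⋃ k : Fin (m n), j n k '' symmDiff (E n) (φ g '' E n) := by
      simp only [Set.image_iUnion, himg, Set.image_symmDiff (hj n _)]
      rintro x (⟨hx, hx'⟩ | ⟨hx, hx'⟩) <;> obtain ⟨k, hk⟩ := Set.mem_iUnion.1 hx
      · exact Set.mem_iUnion.2 ⟨k, .inl ⟨hk, fun h => hx' (Set.mem_iUnion.2 ⟨k, h⟩)⟩⟩
      · exact Set.mem_iUnion.2 ⟨k, .inr ⟨hk, fun h => hx' (Set.mem_iUnion.2 ⟨k, h⟩)⟩⟩
    refine (Set.ncard_le_ncard hsub (Set.finite_iUnion fun k => hfin.image _)).trans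
      ((Set.ncard_iUnion_le_of_fintype _).trans ?_)
    simp [Set.ncard_image_of_injective _ (hj n _)]
  have hm' : (0 : ℝ) < m n := by exact_mod_cast Nat.pos_of_ne_zero (hm n)
  calc _ ≤ ((m n * (symmDiff (E n) (φ g '' E n)).ncard : ℕ) : ℝ) /
        ((m n * (E n).ncard : ℕ) : ℝ) := by
        simp only [hcard]
        gcongr
    _ = _ := by
        push_cast
        exact mul_div_mul_left _ _ hm'.ne'

/-- In an infinite group, finite sets can be made pairwise disjoint by right translations. -/
theorem exists_pairwise_disjoint_image_mul_right {G : Type*} [Group G] [Infinite G]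
    {K : ℕ → Set G} (hK : ∀ n, (K n).Finite) :
    ∃ g : ℕ → G, Pairwise fun m n => Disjoint ((· * g m) '' K m) ((· * g n) '' K n) := by
  have hnext : ∀ (n : ℕ) (p : ∀ m < n, G),
      ∃ y : G, ∀ m (h : m < n), Disjoint ((· * p m h) '' K m) ((· * y) '' K n) := by
    intro n p
    have hfin : (⋃ m : Fin n, Set.image2 (fun a b => b⁻¹ * (a * p m m.2)) (K m) (K n)).Finite :=
      Set.finite_iUnion fun m => (hK m).image2 _ (hK n)
    obtain ⟨y, hy⟩ := hfin.exists_notMem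
    refine ⟨y, fun m h => Set.disjoint_left.2 ?_⟩
    rintro _ ⟨a, ha, rfl⟩ ⟨b, hb, hab⟩
    refine hy (Set.mem_iUnion.2 ⟨⟨m, h⟩, a, ha, b, hb, ?_⟩)
    rw [inv_mul_eq_iff_eq_mul]
    exact hab.symm
  choose next hnext using hnext
  let g : ℕ → G := fun n => Nat.strongRec (motive := fun _ => G) next n
  have hg : ∀ n, g n = next n fun m _ => g m := fun n => by
    simp only [g]
    rw [Nat.strongRec]
  have hlt : ∀ m n, m < n → Disjoint ((· * g m) '' K m) ((· * g n) '' K n) := by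
    intro m n h
    rw [hg n]
    exact hnext n (fun m _ => g m) m h
  exact ⟨g, fun m n hmn => hmn.lt_or_gt.elim (hlt m n) fun h => (hlt n m h).symm⟩

/-- Corollary 2.9 (Moon, arXiv:1003.3998): the triple `(G, H, A)` is in the class `𝒜'`.
Let `G` and `H` be countable groups and `A` a common finite subgroup (given by injective
homomorphisms `iG`, `iH`). If `G` is infinite amenable and there is a countable `H`-set `Y`
with amenable `H`-action on which `A` acts freely, then there are a countable `G`-set `X'`
and a countable `H`-set `Y'` satisfying the conditions (i)-(iv) defining the class `𝒜'`. -/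
theorem triple_mem_classA'
    (G H A : Type) [Group G] [Group H] [Group A]
    [Countable G] [Countable H] [Finite A] [Infinite G]
    (hG : AmenableGroup G)
    (iG : A →* G) (iH : A →* H)
    (hiG : Function.Injective iG) (hiH : Function.Injective iH)
    (Y : Type) [Countable Y] (ψ : H →* Equiv.Perm Y)
    (hamen : AmenableAction ψ)
    (hfree : ∀ (a : A) (y : Y), ψ (iH a) y = y → a = 1) :
    ∃ (X' : Type) (_ : Countable X') (φ' : G →* Equiv.Perm X')
      (Y' : Type) (_ : Countable Y') (ψ' : H →* Equiv.Perm Y'),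
      (∀ x y : X', ∃ g : G, φ' g x = y) ∧
      (∀ g : G, g ∉ Set.range iG →
        {x : X' | ∀ a b : A, φ' (iG a) x ≠ φ' g (φ' (iG b) x)}.Infinite) ∧
      (∀ h : H, h ∉ Set.range iH →
        {y : Y' | ∀ a b : A, ψ' (iH a) y ≠ ψ' h (ψ' (iH b) y)}.Infinite) ∧
      (∃ (C : ℕ → Set X') (D : ℕ → Set Y'),
        IsFolnerSeq φ' C ∧ IsFolnerSeq ψ' D ∧
        (∀ n, (C n).ncard = (D n).ncard) ∧
        (Pairwise fun m n =>
          Disjoint (⋃ a : A, φ' (iG a) '' C m) (⋃ a : A, φ' (iG a) '' C n)) ∧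
        (Pairwise fun m n =>
          Disjoint (⋃ a : A, ψ' (iH a) '' D m) (⋃ a : A, ψ' (iH a) '' D n))) ∧
      (∀ (a : A) (x : X'), φ' (iG a) x = x → a = 1) ∧
      (∀ (a : A) (y : Y'), ψ' (iH a) y = y → a = 1) := by
  obtain ⟨E, hE⟩ := hG.exists_isFolnerSeq
  obtain ⟨F, hF⟩ := hamen.exists_isFolnerSeq
  have hEcard : ∀ n, (E n).ncard ≠ 0 := fun n => ((hE.1 n).2.ncard_pos (hE.1 n).1).ne'
  have hFcard : ∀ n, (F n).ncard ≠ 0 := fun n => ((hF.1 n).2.ncard_pos (hF.1 n).1).ne'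
  let AE : ℕ → Set G := fun n => ⋃ a : A, (iG a * ·) '' E n
  have hEAE : ∀ n, E n ⊆ AE n := fun n x hx => Set.mem_iUnion.2 ⟨1, x, hx, by simp⟩
  obtain ⟨t, ht⟩ := exists_pairwise_disjoint_image_mul_right
    (K := fun i => AE (Nat.unpair i).1)
    fun i => Set.finite_iUnion fun a => (hE.1 _).1.image _
  have ht' : ∀ n k n' k', (n, k) ≠ (n', k') →
      Disjoint ((· * t (Nat.pair n k)) '' AE n) ((· * t (Nat.pair n' k')) '' AE n') := by
    intro n k n' k' h
    simpa using ht (i := Nat.pair n k) (j := Nat.pair n' k') fun h' => h (by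
      simpa [Nat.pair_eq_pair] using h')
  let ψ' : H →* Equiv.Perm ((Y ⊕ H) × ℕ × ℕ) :=
    { toFun := fun h => Equiv.prodCongr (Equiv.sumCongr (ψ h) (Equiv.mulLeft h)) (Equiv.refl _)
      map_one' := by ext1 ⟨y | y, n⟩ <;> simp
      map_mul' := fun h h' => by ext1 ⟨y | y, n⟩ <;> simp [mul_assoc] }
  have hψl : ∀ h y n, ψ' h (.inl y, n) = (.inl (ψ h y), n) := fun _ _ _ => rfl
  have hψr : ∀ h y n, ψ' h (.inr y, n) = (.inr (h * y), n) := fun _ _ _ => rfl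
  have hψn : ∀ h p, (ψ' h p).2 = p.2 := fun _ _ => rfl
  obtain ⟨hC, hCcard⟩ := hE.iUnion_image (φ' := MulAction.toPermHom G G)
    (m := fun n => (F n).ncard) hFcard (j := fun n k x => x * t (Nat.pair n k))
    (fun _ _ => mul_left_injective _) (fun _ _ _ _ => mul_assoc _ _ _)
    fun n k l hkl => (ht' n k n l (by simpa using hkl)).mono
      (Set.image_mono (hEAE n)) (Set.image_mono (hEAE n))
  obtain ⟨hD, hDcard⟩ := hF.iUnion_image (φ' := ψ')
    (m := fun n => (E n).ncard) hEcard (j := fun n k y => (.inl y, n, k))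
    (fun _ _ _ _ h => by simpa using h) (fun _ _ _ _ => rfl)
    fun n k l hkl => Set.disjoint_left.2 (by
      rintro _ ⟨x, -, rfl⟩ ⟨y, -, h⟩
      exact hkl (by simpa using (congrArg (fun p => p.2.2) h).symm))
  refine ⟨G, inferInstance, MulAction.toPermHom G G, (Y ⊕ H) × ℕ × ℕ, inferInstance, ψ',
    fun x y => ⟨y * x⁻¹, inv_mul_cancel_right y x⟩, fun g hg => ?_, fun h hh => ?_,
    ⟨_, _, hC, hD, fun n => ?_, fun m n hmn => ?_, fun m n hmn => ?_⟩, fun a x hx => ?_, ?_⟩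
  · refine Set.infinite_univ.mono fun x _ a b hab => hg ⟨a * b⁻¹, ?_⟩
    have hab : iG a * x = g * (iG b * x) := hab
    rw [← mul_assoc] at hab
    rw [map_mul, map_inv, mul_right_cancel hab, mul_inv_cancel_right]
  · refine (Set.infinite_range_of_injective (f := fun n : ℕ =>
      ((.inr 1, n, 0) : (Y ⊕ H) × ℕ × ℕ)) fun m n hmn => by simpa using hmn).mono ?_
    rintro _ ⟨n, rfl⟩ a b hab
    refine hh ⟨a * b⁻¹, ?_⟩
    have hab : iH a = h * iH b := by simpa [hψr] using hab
    rw [map_mul, map_inv, hab, mul_inv_cancel_right]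
  · rw [hCcard, hDcard, mul_comm]
  · simp only [Set.image_iUnion, Set.disjoint_iUnion_left, Set.disjoint_iUnion_right]
    intro a k b l
    have hsub : ∀ (n k : ℕ) (a : A), MulAction.toPermHom G G (iG a) ''
        ((fun x => x * t (Nat.pair n k)) '' E n) ⊆ (· * t (Nat.pair n k)) '' AE n := by
      rintro n k a _ ⟨_, ⟨x, hx, rfl⟩, rfl⟩
      exact ⟨iG a * x, Set.mem_iUnion.2 ⟨a, x, hx, rfl⟩, mul_assoc _ _ _⟩
    exact (ht' _ _ _ _ fun h => hmn (Prod.ext_iff.1 h).1).mono (hsub _ _ _) (hsub _ _ _)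
  · simp only [Set.image_iUnion, Set.disjoint_iUnion_left, Set.disjoint_iUnion_right]
    intro a k b l
    refine Set.disjoint_left.2 ?_
    rintro _ ⟨_, ⟨x, -, rfl⟩, rfl⟩ ⟨_, ⟨y, -, rfl⟩, h⟩
    exact hmn (congrArg (fun p => p.2.1) h).symm
  · have hx : iG a * x = x := hx
    exact hiG (by rw [mul_eq_right.1 hx, map_one])
  · rintro a ⟨y | y, n⟩ h
    · exact hfree a y (by simpa [hψl] using h)
    · exact hiH (by simpa [hψr] using h)
end
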